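/- arXiv:1504.02250 — 2 statements merged into one kernel-verified Lean document; each statement's English description precedes it below -/
import Mathlib

section
/- Let G be a graph with Gallai–Edmonds decomposition D(G), A(G), C(G) and associated bipartite graph G_B. If some maximum matching in G is uniquely restricted, then: every component of G[C(G)] has a unique perfect matching; every component H of G[D(G)] has a vertex h such that H − h has a unique perfect matching; and G_B has a uniquely restricted maximum matching all of whose edges aH satisfy that a has a unique neighbor h in V(H) with H − h having a unique perfect matching. -/
variable {V : Type*}

/-- `M` is a matching in `G`: a set of edges of `G` that are pairwise disjoint. -/
def IsMatchingSet (G : SimpleGraph V) (M : Set (Sym2 V)) : Prop :=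
  M ⊆ G.edgeSet ∧ ∀ e ∈ M, ∀ f ∈ M, e ≠ f → ∀ v : V, v ∈ e → v ∉ f

/-- `V(M)`: the set of vertices covered by the matching `M`. -/
def matVerts (M : Set (Sym2 V)) : Set V := {v | ∃ e ∈ M, v ∈ e}

/-- `M` is a maximum matching in `G`. -/
def IsMaximumMatching (G : SimpleGraph V) (M : Set (Sym2 V)) : Prop :=
  IsMatchingSet G M ∧ ∀ M', IsMatchingSet G M' → M'.ncard ≤ M.ncard

/-- `M` is uniquely restricted: no matching distinct from `M` covers the same vertices. -/
def UniquelyRestricted (G : SimpleGraph V) (M : Set (Sym2 V)) : Prop :=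
  ∀ M', IsMatchingSet G M' → matVerts M' = matVerts M → M' = M

/-- `M` is a perfect matching of `G`. -/
def IsPerfectMatchingSet (G : SimpleGraph V) (M : Set (Sym2 V)) : Prop :=
  IsMatchingSet G M ∧ matVerts M = Set.univ

/-- `A, B` form a bipartition of `G`. -/
def IsBipartition (G : SimpleGraph V) (A B : Set V) : Prop :=
  Disjoint A B ∧ A ∪ B = Set.univ ∧
    ∀ ⦃u v : V⦄, G.Adj u v → (u ∈ A ∧ v ∈ B) ∨ (u ∈ B ∧ v ∈ A)

/-- `I` is an independent set in `G`. -/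
def IsIndepSet (G : SimpleGraph V) (I : Set V) : Prop :=
  ∀ u ∈ I, ∀ v ∈ I, ¬ G.Adj u v

/-- `I` is a maximum independent set in `G`. -/
def IsMaximumIndepSet (G : SimpleGraph V) (I : Set V) : Prop :=
  IsIndepSet G I ∧ ∀ J, IsIndepSet G J → J.ncard ≤ I.ncard

/-- The arcs of the digraph `D(M)`: edges not in `M` oriented from `A` to `B`,
edges of `M` oriented from `B` to `A`. -/
def DMarc (G : SimpleGraph V) (A B : Set V) (M : Set (Sym2 V)) (u v : V) : Prop :=
  G.Adj u v ∧ ((u ∈ A ∧ v ∈ B ∧ s(u, v) ∉ M) ∨ (u ∈ B ∧ v ∈ A ∧ s(u, v) ∈ M))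

/-- The digraph `D(M)` is acyclic. -/
def DMAcyclic (G : SimpleGraph V) (A B : Set V) (M : Set (Sym2 V)) : Prop :=
  ∀ v : V, ¬ Relation.TransGen (DMarc G A B M) v v

/-- `V⁺(M)`: vertices reachable in `D(M)` from an `A`-vertex uncovered by `M`. -/
def Vplus (G : SimpleGraph V) (A B : Set V) (M : Set (Sym2 V)) : Set V :=
  {v | ∃ a ∈ A, a ∉ matVerts M ∧ Relation.ReflTransGen (DMarc G A B M) a v}

/-- `V⁻(M)`: vertices from which a `B`-vertex uncovered by `M` is reachable in `D(M)`. -/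
def Vminus (G : SimpleGraph V) (A B : Set V) (M : Set (Sym2 V)) : Set V :=
  {v | ∃ b ∈ B, b ∉ matVerts M ∧ Relation.ReflTransGen (DMarc G A B M) v b}

/-- Given a linear ordering `l` of an independent set, `Mσ G l` is the set of edges
`y·p(y)` where `p(y)` is the first vertex of `l` adjacent to `y`. -/
def Msigma (G : SimpleGraph V) (l : List V) : Set (Sym2 V) :=
  {e | ∃ (i : Fin l.length) (y : V), e = s(y, l.get i) ∧ G.Adj (l.get i) y ∧
      ∀ j : Fin l.length, (j : ℕ) < (i : ℕ) → ¬ G.Adj (l.get j) y}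

/-- `l` is an accessibility ordering of `I`: it enumerates `I` without repetition
and `Mσ` is a matching. -/
def IsAccessibilityOrdering (G : SimpleGraph V) (I : Set V) (l : List V) : Prop :=
  l.Nodup ∧ {v | v ∈ l} = I ∧ IsMatchingSet G (Msigma G l)

/-- A partial accessibility ordering: an accessibility ordering of a subset of `I`. -/
def IsPartialAccessibilityOrdering (G : SimpleGraph V) (I : Set V) (l : List V) : Prop :=
  l.Nodup ∧ {v | v ∈ l} ⊆ I ∧ IsMatchingSet G (Msigma G l)

/-- `c` is an `M`-alternating cycle: of every two adjacent edges exactly one is in `M`. -/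
def IsAlternatingCycle (G : SimpleGraph V) (M : Set (Sym2 V)) {v : V} (c : G.Walk v v) : Prop :=
  c.IsCycle ∧ (c.edges ++ c.edges.take 1).Chain' (fun e f => e ∈ M ↔ f ∉ M)

/-- `M'` arises from `M` by a single edge exchange. -/
def EdgeExchange (G : SimpleGraph V) (A B : Set V) (M M' : Set (Sym2 V)) : Prop :=
  (∃ a a' b' : V, a ∈ A ∧ a ∉ matVerts M ∧ s(a', b') ∈ M ∧ G.Adj a b' ∧
      M' = (M \ {s(a', b')}) ∪ {s(a, b')}) ∨
  (∃ b a' b' : V, b ∈ B ∧ b ∉ matVerts M ∧ s(a', b') ∈ M ∧ G.Adj a' b ∧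
      M' = (M \ {s(a', b')}) ∪ {s(a', b)})

/-- Gallai–Edmonds `D(G)`: vertices missed by some maximum matching. -/
def Dset (G : SimpleGraph V) : Set V :=
  {v | ∃ M, IsMaximumMatching G M ∧ v ∉ matVerts M}

/-- Gallai–Edmonds `A(G)`: vertices outside `D(G)` with a neighbor in `D(G)`. -/
def Aset (G : SimpleGraph V) : Set V :=
  {v | v ∉ Dset G ∧ ∃ u ∈ Dset G, G.Adj v u}

/-- Gallai–Edmonds `C(G)`: the remaining vertices. -/
def Cset (G : SimpleGraph V) : Set V :=
  {v | v ∉ Dset G ∧ v ∉ Aset G}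

/-- The vertex set of the connected component `H` of `G[S]`, as a subset of `V`. -/
def compSet (G : SimpleGraph V) (S : Set V) (H : (G.induce S).ConnectedComponent) : Set V :=
  {v | ∃ hv : v ∈ S, (G.induce S).connectedComponentMk ⟨v, hv⟩ = H}

/-- The components of `G[D(G)]`. -/
abbrev DComp (G : SimpleGraph V) := (G.induce (Dset G)).ConnectedComponent

/-- The bipartite graph `G_B`: vertices are `A(G)` together with the components of
`G[D(G)]`; `a` is adjacent to a component `H` iff `a` has a neighbor in `V(H)`. -/
def GB (G : SimpleGraph V) : SimpleGraph (↥(Aset G) ⊕ DComp G) :=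
  SimpleGraph.fromRel (fun x y => ∃ (a : ↥(Aset G)) (H : DComp G),
    x = Sum.inl a ∧ y = Sum.inr H ∧ ∃ d ∈ compSet G (Dset G) H, G.Adj a.1 d)

/-- `G[T] − h` has a unique perfect matching. -/
def UniquePMminus (G : SimpleGraph V) (T : Set V) (h : V) : Prop :=
  ∃! N : Set (Sym2 ↥(T \ {h})), IsPerfectMatchingSet (G.induce (T \ {h})) N

/-- `f` is an involution encoding a matching of `G`: fixed points are the uncovered vertices, and
every other vertex is matched to its image. -/
def IsMate (G : SimpleGraph V) (f : V → V) : Prop :=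
  (∀ x, f (f x) = x) ∧ ∀ x, f x ≠ x → G.Adj x (f x)

/-- The number of vertices left uncovered by `f`. -/
noncomputable def numFixed (f : V → V) : ℕ := {x | f x = x}.ncard

/-- `f` encodes a maximum matching of `G`. -/
def IsMaxMate (G : SimpleGraph V) (f : V → V) : Prop :=
  IsMate G f ∧ ∀ g, IsMate G g → numFixed f ≤ numFixed g

open Classical in
/-- The function equal to `g` on `S` and to `f` elsewhere. -/
noncomputable def switch (S : Set V) (f g : V → V) (x : V) : V := if x ∈ S then g x else f x

theorem switch_of_mem {S : Set V} {x : V} (f g : V → V) (h : x ∈ S) : switch S f g x = g x :=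
  if_pos h

theorem switch_of_notMem {S : Set V} {x : V} (f g : V → V) (h : x ∉ S) : switch S f g x = f x :=
  if_neg h

theorem notMem_of_closed {f : V → V} (hf : ∀ x, f (f x) = x) {S : Set V}
    (hS : ∀ x ∈ S, f x ∈ S) {x : V} (hx : x ∉ S) : f x ∉ S :=
  fun h => hx (hf x ▸ hS _ h)

theorem IsMate.switch {G : SimpleGraph V} {f g : V → V} (hf : IsMate G f) (hg : IsMate G g)
    {S : Set V} (hSf : ∀ x ∈ S, f x ∈ S) (hSg : ∀ x ∈ S, g x ∈ S) :
    IsMate G (switch S f g) := by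
  refine ⟨fun x => ?_, fun x hx => ?_⟩
  · by_cases h : x ∈ S
    · rw [switch_of_mem _ _ h, switch_of_mem _ _ (hSg x h), hg.1]
    · rw [switch_of_notMem _ _ h, switch_of_notMem _ _ (notMem_of_closed hf.1 hSf h), hf.1]
  · by_cases h : x ∈ S
    · rw [switch_of_mem _ _ h] at hx ⊢
      exact hg.2 x hx
    · rw [switch_of_notMem _ _ h] at hx ⊢
      exact hf.2 x hx

theorem numFixed_switch [Finite V] (f g : V → V) (S : Set V) :
    numFixed (switch S f g) + {x ∈ S | f x = x}.ncard
      = numFixed f + {x ∈ S | g x = x}.ncard := by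
  have split (k : V → V) :
      numFixed k = {x ∈ S | k x = x}.ncard + {x | x ∉ S ∧ k x = x}.ncard := by
    rw [numFixed, ← Set.ncard_union_eq]
    · congr 1
      ext x
      by_cases h : x ∈ S <;> simp [h]
    · rw [Set.disjoint_left]
      exact fun x hx hx' => hx'.1 hx.1
  have h1 : {x ∈ S | switch S f g x = x} = {x ∈ S | g x = x} := by
    ext x
    by_cases h : x ∈ S <;> simp [h, switch_of_mem]
  have h2 : {x | x ∉ S ∧ switch S f g x = x} = {x | x ∉ S ∧ f x = x} := by
    ext x
    by_cases h : x ∈ S <;> simp [h, switch_of_notMem]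
  rw [split (switch S f g), split f, h1, h2]
  omega

/-- The orbit of a fixed point `d` of `g` under two involutions `f` and `g` is a path whose other
end is a fixed point of `f`, or another fixed point of `g`. -/
theorem exists_orbit [Finite V] {f : V → V} (hf : ∀ x, f (f x) = x) (g : V → V)
    (hg : ∀ x, g (g x) = x) (d : V) (hd : g d = d) :
    ∃ S : Set V, d ∈ S ∧ (∀ x ∈ S, f x ∈ S) ∧ (∀ x ∈ S, g x ∈ S) ∧
      ((∃ e ∈ S, ∀ x ∈ S, (g x = x ↔ x = d) ∧ (f x = x ↔ x = e)) ∨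
        (∃ c ∈ S, c ≠ d ∧ ∀ x ∈ S, (g x = x ↔ x = d ∨ x = c) ∧ f x ≠ x)) := by
  classical
  induction hn : {x | f x ≠ g x}.ncard using Nat.strong_induction_on generalizing g d with
  | _ n ih =>
  by_cases hfd : f d = d
  · exact ⟨{d}, rfl, by simp [hfd], by simp [hd], .inl ⟨d, rfl, by simp [hd, hfd]⟩⟩
  by_cases hgy : g (f d) = f d
  · exact ⟨{d, f d}, by simp, by simp [hf], by simp [hd, hgy],
      .inr ⟨f d, by simp, hfd, by simp [hd, hgy, hf, Ne.symm hfd]; exact hfd⟩⟩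
  obtain ⟨y, hy⟩ : ∃ y, y = f d := ⟨_, rfl⟩
  obtain ⟨z, hz⟩ : ∃ z, z = g y := ⟨_, rfl⟩
  rw [← hy] at hfd hgy
  have hfy : f y = d := by rw [hy, hf]
  have hgz : g z = y := by rw [hz, hg]
  rw [← hz] at hgy
  have hzd : z ≠ d := by rintro rfl; exact hfd (hgz.symm.trans hd)
  have hfz : f z ≠ y := fun h => hzd (by rw [← hfy, ← h, hf])
  let g' : V → V := fun x => if x = d then y else if x = y then d else if x = z then z else g x
  have g'd : g' d = y := by simp [g']
  have g'y : g' y = d := by simp [g', hfd]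
  have g'z : g' z = z := by simp [g', hzd, hgy]
  have g'x (x) (h1 : x ≠ d) (h2 : x ≠ y) (h3 : x ≠ z) : g' x = g x := by simp [g', h1, h2, h3]
  have hg' (x) : g' (g' x) = x := by
    by_cases h1 : x = d
    · rw [h1, g'd, g'y]
    by_cases h2 : x = y
    · rw [h2, g'y, g'd]
    by_cases h3 : x = z
    · rw [h3, g'z, g'z]
    rw [g'x x h1 h2 h3, g'x, hg]
    · exact fun h => h1 (by rw [← hg x, h, hd])
    · exact fun h => h3 (by rw [← hg x, h, hz])
    · exact fun h => h2 (by rw [← hg x, h, hgz])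
  have hlt : {x | f x ≠ g' x}.ncard < n := by
    rw [← hn]
    refine Set.ncard_lt_ncard ⟨fun x hx => ?_, fun h => ?_⟩ (Set.toFinite _)
    · by_cases h1 : x = d
      · subst h1; exact absurd (hy.symm.trans g'd.symm) hx
      by_cases h2 : x = y
      · subst h2; exact absurd (hfy.trans g'y.symm) hx
      by_cases h3 : x = z
      · subst h3; exact fun h => hfz (h.trans hgz)
      · rwa [Set.mem_ofPred_eq, g'x x h1 h2 h3] at hx
    · have : d ∈ {x | f x ≠ g x} := by simpa [hd, ← hy] using hfd
      exact h this (by rw [g'd, hy])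
  obtain ⟨S, hzS, hSf, hSg, hS⟩ := ih _ hlt g' hg' z g'z rfl
  have aux (x) (hx : x ∈ S) (hxd : x ≠ d) (hxy : x ≠ y) : g x ∈ insert d (insert y S) := by
    by_cases h3 : x = z
    · rw [h3, hgz]; simp
    · rw [← g'x x hxd hxy h3]; exact .inr (.inr (hSg x hx))
  refine ⟨insert d (insert y S), by simp, ?_, fun x hx => ?_, ?_⟩
  · rintro x (rfl | rfl | hx)
    · rw [← hy]; simp
    · rw [hfy]; simp
    · exact .inr (.inr (hSf x hx))
  · by_cases h1 : x = d
    · rw [h1, hd]; simp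
    by_cases h2 : x = y
    · rw [h2, ← hz]; simp [hzS]
    exact aux x (by simpa [h1, h2] using hx) h1 h2
  · rcases hS with ⟨e, he, hS⟩ | ⟨c, hc, hcz, hS⟩
    · refine .inl ⟨e, by simp [he], fun x hx => ?_⟩
      have hfe := ((hS e he).2).2 rfl
      by_cases h1 : x = d
      · subst h1
        refine ⟨by simp [hd], fun h => absurd (hy.trans h) hfd, ?_⟩
        rintro rfl; exact hfe
      by_cases h2 : x = y
      · subst h2
        refine ⟨⟨fun h => absurd (hz.trans h) hgy, fun h => absurd h h1⟩,
          fun h => absurd (hfy.symm.trans h).symm h1, ?_⟩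
        rintro rfl; exact hfe
      have hxS : x ∈ S := by simpa [h1, h2] using hx
      refine ⟨⟨fun h => ?_, fun h => absurd h h1⟩, (hS x hxS).2⟩
      by_cases h3 : x = z
      · exact absurd (hgz.symm.trans (h3 ▸ h)).symm (h3 ▸ h2)
      · exact absurd ((hS x hxS).1.1 ((g'x x h1 h2 h3).trans h)) h3
    · have hg'c := (hS c hc).1.2 (.inr rfl)
      have hcd : c ≠ d := by rintro rfl; exact hfd (g'd.symm.trans hg'c)
      have hcy : c ≠ y := by rintro rfl; exact hfd (g'y.symm.trans hg'c).symm
      refine .inr ⟨c, by simp [hc], hcd, fun x hx => ?_⟩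
      by_cases h1 : x = d
      · subst h1
        exact ⟨by simp [hd], by rwa [← hy]⟩
      by_cases h2 : x = y
      · subst h2
        exact ⟨⟨fun h => absurd (hz.trans h) hgy, fun h => (h.elim h1 hcy.symm).elim⟩,
          fun h => absurd (hfy.symm.trans h).symm h1⟩
      have hxS : x ∈ S := by simpa [h1, h2] using hx
      refine ⟨⟨fun h => ?_, ?_⟩, (hS x hxS).2⟩
      · by_cases h3 : x = z
        · exact absurd (hgz.symm.trans (h3 ▸ h)).symm (h3 ▸ h2)
        · exact .inr (((hS x hxS).1.1 ((g'x x h1 h2 h3).trans h)).resolve_left h3)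
      · rintro (rfl | rfl)
        · exact absurd rfl h1
        · rw [← g'x x h1 h2 hcz, hg'c]

theorem even_ncard_of_involution {f : V → V} (hf : ∀ x, f (f x) = x) {S : Set V} (hfin : S.Finite)
    (hS : ∀ x ∈ S, f x ∈ S) (hfix : ∀ x ∈ S, f x ≠ x) : Even S.ncard := by
  rw [Set.ncard_eq_toFinset_card S hfin, ← ZMod.natCast_eq_zero_iff_even, Finset.card_eq_sum_ones,
    Nat.cast_sum]
  refine Finset.sum_involution (fun x _ => f x) (fun _ _ => by decide) (fun x hx _ => ?_)
    (fun x hx => ?_) (fun x _ => hf x)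
  · exact hfix x (by simpa using hx)
  · simpa using hS x (by simpa using hx)

theorem numFixed_add [Finite V] (f : V → V) :
    numFixed f + {x | f x ≠ x}.ncard = Nat.card V := by
  rw [← Set.ncard_add_ncard_compl {x | f x = x}]
  rfl

theorem even_moved {f : V → V} [Finite V] (hf : ∀ x, f (f x) = x) : Even {x | f x ≠ x}.ncard :=
  even_ncard_of_involution hf (Set.toFinite _)
    (fun x (hx : f x ≠ x) => by simpa [hf] using hx.symm) (fun _ hx => hx)

theorem IsMaxMate.of_le {G : SimpleGraph V} {f g : V → V} (hf : IsMaxMate G f) (hg : IsMate G g)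
    (h : numFixed g ≤ numFixed f) : IsMaxMate G g :=
  ⟨hg, fun k hk => h.trans (hf.2 k hk)⟩

theorem exists_augment [Finite V] {G : SimpleGraph V} {f : V → V} (hf : IsMate G f) {u v : V}
    (hu : f u = u) (hv : f v = v) (huv : G.Adj u v) :
    ∃ g, IsMate G g ∧ numFixed g + 2 = numFixed f ∧ ∀ x, x ≠ u → x ≠ v → g x = f x := by
  classical
  have hne := huv.ne
  let g : V → V := fun x => if x = u then v else if x = v then u else f x
  have gu : g u = v := by simp [g]
  have gv : g v = u := by simp [g, hne.symm]
  have gx (x) (h1 : x ≠ u) (h2 : x ≠ v) : g x = f x := by simp [g, h1, h2]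
  refine ⟨g, ⟨fun x => ?_, fun x hx => ?_⟩, ?_, gx⟩
  · by_cases h1 : x = u
    · rw [h1, gu, gv]
    by_cases h2 : x = v
    · rw [h2, gv, gu]
    rw [gx x h1 h2, gx, hf.1]
    · exact fun h => h1 (by rw [← hf.1 x, h, hu])
    · exact fun h => h2 (by rw [← hf.1 x, h, hv])
  · by_cases h1 : x = u
    · rwa [h1, gu]
    by_cases h2 : x = v
    · rw [h2, gv]; exact huv.symm
    rw [gx x h1 h2] at hx ⊢
    exact hf.2 x hx
  · have h : {x | f x = x} = insert u (insert v {x | g x = x}) := by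
      ext x
      by_cases h1 : x = u
      · simp [h1, hu]
      by_cases h2 : x = v
      · simp [h2, hv]
      simp [h1, h2, gx x h1 h2]
    rw [numFixed, numFixed, h, Set.ncard_insert_of_notMem, Set.ncard_insert_of_notMem]
    · simpa [gv] using hne
    · simpa [gu, hne] using hne.symm

/-- The Gallai–Edmonds set `D(G)` in terms of involutions. -/
def mateD (G : SimpleGraph V) : Set V := {v | ∃ f, IsMaxMate G f ∧ f v = v}

/-- Avoiding `t` by a maximum matching is possible while keeping all but one uncovered vertex
of a given maximum matching. -/
theorem IsMaxMate.exists_fixed [Finite V] {G : SimpleGraph V} {f : V → V} (hf : IsMaxMate G f)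
    {t : V} (ht : t ∈ mateD G) :
    ∃ g, IsMaxMate G g ∧ g t = t ∧ ∃ e, ∀ x, f x = x → x ≠ e → g x = x := by
  obtain ⟨g, hg, hgt⟩ := ht
  obtain ⟨S, htS, hSf, hSg, ⟨e, he, hS⟩ | ⟨c, hc, hct, hS⟩⟩ :=
    exists_orbit hf.1.1 g hg.1.1 t hgt
  · refine ⟨switch S f g, hf.of_le (hf.1.switch hg.1 hSf hSg) ?_, ?_, e, fun x hx hxe => ?_⟩
    · have h1 := numFixed_switch f g S
      have h2 : {x ∈ S | f x = x} = {e} := by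
        ext x
        refine ⟨fun h => ((hS x h.1).2.1 h.2), ?_⟩
        rintro rfl; exact ⟨he, (hS x he).2.2 rfl⟩
      have h3 : {x ∈ S | g x = x} = {t} := by
        ext x
        refine ⟨fun h => ((hS x h.1).1.1 h.2), ?_⟩
        rintro rfl; exact ⟨htS, hgt⟩
      rw [h2, h3, Set.ncard_singleton, Set.ncard_singleton] at h1
      omega
    · rw [switch_of_mem _ _ htS, hgt]
    · rw [switch_of_notMem _ _ fun h => hxe ((hS x h).2.1 hx), hx]
  · exfalso
    have h1 := numFixed_switch g f S
    have h2 : {x ∈ S | f x = x} = ∅ := by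
      ext x
      exact ⟨fun h => (hS x h.1).2 h.2, fun h => h.elim⟩
    have h3 : 0 < {x ∈ S | g x = x}.ncard :=
      (Set.ncard_pos (Set.toFinite _)).2 ⟨t, htS, hgt⟩
    rw [h2, Set.ncard_empty] at h1
    have := hg.2 _ (hg.1.switch hf.1 hSg hSf)
    omega

/-- Gallai's lemma: a maximum matching misses at most one vertex of each connected set of vertices
that can be missed. -/
theorem IsMaxMate.eq_of_walk [Finite V] {G : SimpleGraph V} {S : Set V} (hS : S ⊆ mateD G)
    {u v : S} (p : (G.induce S).Walk u v) {f : V → V} (hf : IsMaxMate G f)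
    (hu : f u = u) (hv : f v = v) : u = v := by
  induction p generalizing f with
  | nil => rfl
  | @cons u w v huw p ih =>
    by_contra huv
    have adj : ∀ g, IsMaxMate G g → g u = u → g w = w → False := by
      intro g hg h1 h2
      obtain ⟨k, hk, hc, -⟩ := exists_augment hg.1 h1 h2 huw
      have := hg.2 k hk
      omega
    obtain ⟨g, hg, hgw, e, hge⟩ := hf.exists_fixed (hS w.2)
    by_cases hue : (u : V) = e
    · have hve : (v : V) ≠ e := fun h => huv (Subtype.ext (hue.trans h.symm))
      have := ih hg hgw (hge v hv hve)
      subst this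
      exact adj f hf hu hv
    · exact adj g hg (hge u hu hue) hgw

/-- `G` with the vertices of `B` isolated. -/
def isolate (G : SimpleGraph V) (B : Set V) : SimpleGraph V where
  Adj x y := G.Adj x y ∧ x ∉ B ∧ y ∉ B
  symm := ⟨fun _ _ h => ⟨h.1.symm, h.2.2, h.2.1⟩⟩
  loopless := ⟨fun _ h => h.1.ne rfl⟩

open Classical in
/-- The matching `f` with all edges meeting `B` removed. -/
noncomputable def uncover (f : V → V) (B : Set V) (x : V) : V :=
  if x ∈ B ∨ f x ∈ B then x else f x

theorem uncover_of_mem {f : V → V} {B : Set V} {x : V} (h : x ∈ B ∨ f x ∈ B) :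
    uncover f B x = x := if_pos h

theorem uncover_of_notMem {f : V → V} {B : Set V} {x : V} (h : ¬ (x ∈ B ∨ f x ∈ B)) :
    uncover f B x = f x := if_neg h

theorem uncover_of_fixed {f : V → V} (B : Set V) {x : V} (h : f x = x) : uncover f B x = x := by
  unfold uncover
  split_ifs
  exacts [rfl, h]

theorem isMate_isolate_iff {G : SimpleGraph V} {B : Set V} {f : V → V} :
    IsMate (isolate G B) f ↔ IsMate G f ∧ ∀ x ∈ B, f x = x := by
  constructor
  · refine fun h => ⟨⟨h.1, fun x hx => (h.2 x hx).1⟩, fun x hx => ?_⟩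
    by_contra hne
    exact (h.2 x hne).2.1 hx
  · refine fun ⟨h, hB⟩ => ⟨h.1, fun x hx => ⟨h.2 x hx, fun hxB => hx (hB x hxB), fun hxB => ?_⟩⟩
    have := hB _ hxB
    rw [h.1] at this
    exact hx this.symm

theorem IsMate.uncover {G : SimpleGraph V} {f : V → V} (hf : IsMate G f) (B : Set V) :
    IsMate (isolate G B) (uncover f B) := by
  refine isMate_isolate_iff.2 ⟨⟨fun x => ?_, fun x hx => ?_⟩, fun x hx => uncover_of_mem (.inl hx)⟩
  · by_cases h : x ∈ B ∨ f x ∈ B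
    · rw [uncover_of_mem h, uncover_of_mem h]
    · have h' : ¬ (f x ∈ B ∨ f (f x) ∈ B) := by rw [hf.1]; tauto
      rw [uncover_of_notMem h, uncover_of_notMem h', hf.1]
  · by_cases h : x ∈ B ∨ f x ∈ B
    · exact absurd (uncover_of_mem h) hx
    · rw [uncover_of_notMem h] at hx ⊢
      exact hf.2 x hx

theorem uncover_insert (f : V → V) (B : Set V) (b : V) :
    uncover f (insert b B) = uncover (uncover f B) {b} := by
  ext x
  by_cases h : x ∈ B ∨ f x ∈ B
  · rw [uncover_of_mem (by simp only [Set.mem_insert_iff]; tauto),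
      uncover_of_fixed _ (uncover_of_mem h)]
  · by_cases hb : x = b ∨ f x = b
    · rw [uncover_of_mem (by simp only [Set.mem_insert_iff]; tauto),
        uncover_of_mem (by rw [uncover_of_notMem h]; exact hb)]
    · rw [uncover_of_notMem (by simp only [Set.mem_insert_iff]; tauto),
        uncover_of_notMem (by rw [uncover_of_notMem h]; exact hb), uncover_of_notMem h]

theorem numFixed_uncover_singleton [Finite V] {f : V → V} (hf : ∀ x, f (f x) = x) {b : V}
    (hb : f b ≠ b) : numFixed (uncover f {b}) = numFixed f + 2 := by
  have h : {x | uncover f {b} x = x} = insert b (insert (f b) {x | f x = x}) := by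
    ext x
    by_cases h1 : x = b
    · simp [uncover, h1]
    by_cases h2 : x = f b
    · simp [uncover, h2, hf]
    have h3 : f x ≠ b := fun h => h2 (by rw [← h, hf])
    simp [uncover, h1, h2, h3]
  rw [numFixed, h, Set.ncard_insert_of_notMem, Set.ncard_insert_of_notMem]
  · rfl
  · simpa [hf] using hb.symm
  · simp [hb, hb.symm]

/-- Stability lemma, for one vertex. -/
theorem mem_mateD_of_fixed [Finite V] {G : SimpleGraph V} {b d t : V} (hb : b ∉ mateD G)
    (hd : d ∈ mateD G) (hbd : G.Adj b d) {k : V → V} (hk : IsMate G k) (hkb : k b = b)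
    (hkt : k t = t) (htb : t ≠ b) (hle : ∀ f, IsMaxMate G f → numFixed k ≤ numFixed f + 2) :
    t ∈ mateD G := by
  obtain ⟨f, hf, hfd⟩ := hd
  specialize hle f hf
  obtain ⟨S, hbS, hSf, hSk, ⟨e, he, hS⟩ | ⟨c, hc, hcb, hS⟩⟩ :=
    exists_orbit hf.1.1 k hk.1 b hkb
  · exfalso
    refine hb ⟨switch S f k, hf.of_le (hf.1.switch hk hSf hSk) ?_, ?_⟩
    · have h1 := numFixed_switch f k S
      have h2 : {x ∈ S | f x = x} = {e} := by
        ext x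
        refine ⟨fun h => ((hS x h.1).2.1 h.2), ?_⟩
        rintro rfl; exact ⟨he, (hS x he).2.2 rfl⟩
      have h3 : {x ∈ S | k x = x} = {b} := by
        ext x
        refine ⟨fun h => ((hS x h.1).1.1 h.2), ?_⟩
        rintro rfl; exact ⟨hbS, hkb⟩
      rw [h2, h3, Set.ncard_singleton, Set.ncard_singleton] at h1
      omega
    · rw [switch_of_mem _ _ hbS, hkb]
  · have h2 : {x ∈ S | f x = x} = ∅ := by
      ext x
      exact ⟨fun h => (hS x h.1).2 h.2, fun h => h.elim⟩
    have h3 : {x ∈ S | k x = x} = {b, c} := by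
      ext x
      refine ⟨fun h => ((hS x h.1).1.1 h.2), ?_⟩
      rintro (rfl | rfl)
      · exact ⟨hbS, hkb⟩
      · exact ⟨hc, (hS x hc).1.2 (.inr rfl)⟩
    by_cases hct : c = t
    · subst hct
      have h1 := numFixed_switch f k S
      rw [h2, h3, Set.ncard_empty, Set.ncard_pair hcb.symm] at h1
      have hdS : d ∉ S := fun h => (hS d h).2 hfd
      obtain ⟨g, hg, hgc, hgx⟩ := exists_augment (hf.1.switch hk hSf hSk) (u := b) (v := d)
        (by rw [switch_of_mem _ _ hbS, hkb]) (by rw [switch_of_notMem _ _ hdS, hfd]) hbd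
      refine ⟨g, hf.of_le hg (by omega), ?_⟩
      rw [hgx c hcb (by rintro rfl; exact hdS hc), switch_of_mem _ _ hc, hkt]
    · have h1 := numFixed_switch k f S
      rw [h2, h3, Set.ncard_empty, Set.ncard_pair hcb.symm] at h1
      refine ⟨switch S k f, hf.of_le (hk.switch hf.1 hSk hSf) (by omega), ?_⟩
      rw [switch_of_notMem, hkt]
      exact fun h => ((hS t h).1.1 hkt).elim htb (fun h => hct h.symm)

/-- Stability lemma: isolating a set `B` of vertices outside `D(G)` with neighbors in `D(G)`. -/
theorem isMaxMate_uncover [Finite V] {G : SimpleGraph V} (B : Set V)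
    (hB : ∀ b ∈ B, b ∉ mateD G ∧ ∃ d ∈ mateD G, G.Adj b d) :
    (∀ f, IsMaxMate G f → IsMaxMate (isolate G B) (uncover f B)) ∧
      mateD (isolate G B) ⊆ mateD G ∪ B := by
  induction B, Set.toFinite B using Set.Finite.induction_on with
  | empty =>
    have h1 : isolate G ∅ = G := by ext; simp [isolate]
    have h2 (f : V → V) : uncover f ∅ = f := by ext; simp [uncover]
    simp [h1, h2]
  | @insert b B hbB _ ih =>
    obtain ⟨ih1, ih2⟩ := ih fun x hx => hB x (.inr hx)
    obtain ⟨hb, d, hd, hbd⟩ := hB b (.inl rfl)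
    have hdB : d ∉ B := fun h => (hB d (.inr h)).1 hd
    have hb' : b ∉ mateD (isolate G B) := fun h => (ih2 h).elim hb hbB
    have hd' : d ∈ mateD (isolate G B) := by
      obtain ⟨f, hf, hfd⟩ := hd
      exact ⟨_, ih1 f hf, by simp [uncover, hfd]⟩
    have hiso : isolate G (insert b B) = isolate (isolate G B) {b} := by
      ext x y
      simp only [isolate, Set.mem_insert_iff, Set.mem_singleton_iff]
      tauto
    have hcount (f) (hf : IsMaxMate (isolate G B) f) :
        numFixed (uncover f {b}) = numFixed f + 2 :=
      numFixed_uncover_singleton hf.1.1 fun h => hb' ⟨f, hf, h⟩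
    have hmax (f) (hf : IsMaxMate (isolate G B) f) :
        IsMaxMate (isolate (isolate G B) {b}) (uncover f {b}) := by
      refine ⟨hf.1.uncover _, fun k hk => ?_⟩
      rw [hcount f hf]
      obtain ⟨hk, hkb⟩ := isMate_isolate_iff.1 hk
      have h1 : ¬ numFixed k ≤ numFixed f := fun h => hb' ⟨k, hf.of_le hk h, hkb b rfl⟩
      have h2 := numFixed_add f
      have h3 := numFixed_add k
      obtain ⟨m, hm⟩ := even_moved hf.1.1
      obtain ⟨n, hn⟩ := even_moved hk.1
      omega
    rw [hiso]
    refine ⟨fun f hf => ?_, ?_⟩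
    · rw [uncover_insert]
      exact hmax _ (ih1 f hf)
    · rintro t ⟨k, hk, hkt⟩
      obtain ⟨hk', hkb⟩ := isMate_isolate_iff.1 hk.1
      by_cases htb : t = b
      · exact .inr (.inl htb)
      have := mem_mateD_of_fixed hb' hd' ⟨hbd, hbB, hdB⟩ hk' (hkb b rfl) hkt htb fun f hf => by
        rw [← hcount f hf]
        exact hk.2 _ (hmax f hf).1
      exact (ih2 this).imp id .inr

/-- The set of edges encoded by `f`. -/
def mateEdges (f : V → V) : Set (Sym2 V) := {e | ∃ x, f x ≠ x ∧ e = s(x, f x)}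

theorem eq_of_mem_mateEdges {f : V → V} (hf : ∀ x, f (f x) = x) {e : Sym2 V}
    (he : e ∈ mateEdges f) {v : V} (hv : v ∈ e) : f v ≠ v ∧ e = s(v, f v) := by
  obtain ⟨x, hx, rfl⟩ := he
  rcases Sym2.mem_iff.1 hv with rfl | rfl
  · exact ⟨hx, rfl⟩
  · exact ⟨by rw [hf]; exact hx.symm, by rw [hf, Sym2.eq_swap]⟩

theorem IsMate.isMatchingSet {G : SimpleGraph V} {f : V → V} (hf : IsMate G f) :
    IsMatchingSet G (mateEdges f) := by
  refine ⟨?_, fun e he e' he' hne v hv hv' => hne ?_⟩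
  · rintro _ ⟨x, hx, rfl⟩
    exact hf.2 x hx
  · rw [(eq_of_mem_mateEdges hf.1 he hv).2, (eq_of_mem_mateEdges hf.1 he' hv').2]

theorem matVerts_mateEdges {f : V → V} (hf : ∀ x, f (f x) = x) :
    matVerts (mateEdges f) = {x | f x ≠ x} := by
  ext x
  exact ⟨fun ⟨e, he, hx⟩ => (eq_of_mem_mateEdges hf he hx).1,
    fun hx => ⟨_, ⟨x, hx, rfl⟩, Sym2.mem_mk_left _ _⟩⟩

theorem mateEdges_injOn {f g : V → V} (hf : ∀ x, f (f x) = x) (hg : ∀ x, g (g x) = x)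
    (h : mateEdges f = mateEdges g) : f = g := by
  ext x
  have key := congrArg matVerts h
  rw [matVerts_mateEdges hf, matVerts_mateEdges hg, Set.ext_iff] at key
  by_cases hx : f x = x
  · rw [hx]
    by_contra hne
    exact (key x).2 (Ne.symm hne) hx
  · have : s(x, f x) ∈ mateEdges g := h ▸ ⟨x, hx, rfl⟩
    exact Sym2.congr_right.1 (eq_of_mem_mateEdges hg this (Sym2.mem_mk_left _ _)).2

theorem IsMatchingSet.eq_of_mem {G : SimpleGraph V} {M : Set (Sym2 V)} (hM : IsMatchingSet G M)
    {x y z : V} (hy : s(x, y) ∈ M) (hz : s(x, z) ∈ M) : y = z := by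
  by_contra hne
  exact hM.2 _ hy _ hz (fun h => hne (Sym2.congr_right.1 h)) x (Sym2.mem_mk_left _ _)
    (Sym2.mem_mk_left _ _)

theorem IsMatchingSet.exists_mate {G : SimpleGraph V} {M : Set (Sym2 V)}
    (hM : IsMatchingSet G M) : ∃ f, IsMate G f ∧ mateEdges f = M := by
  classical
  have hirr (x) : s(x, x) ∉ M := fun h => (G.mem_edgeSet.1 (hM.1 h)).ne rfl
  let f : V → V := fun x => if h : ∃ y, s(x, y) ∈ M then h.choose else x
  have f1 (x y) (h : s(x, y) ∈ M) : f x = y := by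
    have h' : ∃ y, s(x, y) ∈ M := ⟨y, h⟩
    have : f x = h'.choose := dif_pos h'
    rw [this]
    exact hM.eq_of_mem h'.choose_spec h
  have f2 (x) (h : f x ≠ x) : s(x, f x) ∈ M := by
    by_cases h' : ∃ y, s(x, y) ∈ M
    · obtain ⟨y, hy⟩ := h'
      rwa [f1 x y hy]
    · exact absurd (dif_neg h') h
  refine ⟨f, ⟨fun x => ?_, fun x hx => hM.1 (f2 x hx)⟩, ?_⟩
  · by_cases h : f x = x
    · rw [h, h]
    · exact f1 _ _ (Sym2.eq_swap ▸ f2 x h)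
  · ext e
    constructor
    · rintro ⟨x, hx, rfl⟩
      exact f2 x hx
    · induction e with
      | _ x y =>
        intro h
        have hxy := f1 x y h
        refine ⟨x, ?_, by rw [hxy]⟩
        rw [hxy]
        rintro rfl
        exact hirr _ h

theorem two_mul_ncard_mateEdges [Finite V] {f : V → V} (hf : ∀ x, f (f x) = x) :
    2 * (mateEdges f).ncard = {x | f x ≠ x}.ncard := by
  classical
  have := Fintype.ofFinite V
  let s : Finset V := Finset.univ.filter fun x => f x ≠ x
  have h1 : mateEdges f = (s.image fun x => s(x, f x) : Finset (Sym2 V)) := by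
    ext e
    simp only [mateEdges, Set.mem_ofPred_eq, Finset.coe_image, Set.mem_image, s, Finset.coe_filter,
      Finset.mem_univ, true_and]
    exact exists_congr fun x => and_congr_right fun _ => eq_comm
  have h2 : {x | f x ≠ x} = (s : Set V) := by
    ext x
    simp [s]
  rw [h1, h2, Set.ncard_coe_finset, Set.ncard_coe_finset,
    Finset.card_eq_sum_card_image (fun x => s(x, f x)) s, mul_comm]
  refine (Finset.sum_const_nat fun e he => ?_).symm
  obtain ⟨x, hx, rfl⟩ := Finset.mem_image.1 he
  have hx : f x ≠ x := by simpa [s] using hx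
  rw [show {a ∈ s | s(a, f a) = s(x, f x)} = {x, f x} from ?_, Finset.card_pair hx.symm]
  ext a
  simp only [Finset.mem_filter, Finset.mem_insert, Finset.mem_singleton, s, Finset.mem_univ,
    true_and]
  constructor
  · rintro ⟨-, h⟩
    exact Sym2.mem_iff.1 (h ▸ Sym2.mem_mk_left a (f a))
  · rintro (rfl | rfl)
    · exact ⟨hx, rfl⟩
    · exact ⟨by rw [hf]; exact hx.symm, by rw [hf, Sym2.eq_swap]⟩

theorem isMaximumMatching_mateEdges_iff [Finite V] {G : SimpleGraph V} {f : V → V}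
    (hf : IsMate G f) : IsMaximumMatching G (mateEdges f) ↔ IsMaxMate G f := by
  have key (g : V → V) (hg : IsMate G g) :
      (mateEdges g).ncard ≤ (mateEdges f).ncard ↔ numFixed f ≤ numFixed g := by
    have h1 := two_mul_ncard_mateEdges hf.1
    have h2 := two_mul_ncard_mateEdges hg.1
    have h3 := numFixed_add f
    have h4 := numFixed_add g
    omega
  refine ⟨fun h => ⟨hf, fun g hg => (key g hg).1 (h.2 _ hg.isMatchingSet)⟩,
    fun h => ⟨hf.isMatchingSet, fun N hN => ?_⟩⟩
  obtain ⟨g, hg, rfl⟩ := hN.exists_mate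
  exact (key g hg).2 (h.2 g hg)

theorem Dset_eq_mateD [Finite V] (G : SimpleGraph V) : Dset G = mateD G := by
  ext v
  constructor
  · rintro ⟨M, hM, hv⟩
    obtain ⟨f, hf, rfl⟩ := hM.1.exists_mate
    refine ⟨f, (isMaximumMatching_mateEdges_iff hf).1 hM, ?_⟩
    rw [matVerts_mateEdges hf.1] at hv
    exact not_not.1 hv
  · rintro ⟨f, hf, hv⟩
    refine ⟨mateEdges f, (isMaximumMatching_mateEdges_iff hf.1).2 hf, ?_⟩
    rw [matVerts_mateEdges hf.1.1]
    exact not_not.2 hv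

/-- A matching that is the only one with its set of covered vertices, in terms of involutions. -/
def IsUniqueMate (G : SimpleGraph V) (f : V → V) : Prop :=
  IsMate G f ∧ ∀ g, IsMate G g → (∀ x, g x = x ↔ f x = x) → g = f

theorem UniquelyRestricted.isUniqueMate {G : SimpleGraph V} {f : V → V} (hf : IsMate G f)
    (h : UniquelyRestricted G (mateEdges f)) : IsUniqueMate G f := by
  refine ⟨hf, fun g hg hgf => mateEdges_injOn hg.1 hf.1 (h _ hg.isMatchingSet ?_)⟩
  rw [matVerts_mateEdges hf.1, matVerts_mateEdges hg.1]
  ext x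
  exact not_congr (hgf x)

/-- A uniquely restricted matching restricts to the unique perfect matching on any set of
covered vertices closed under it. -/
theorem IsUniqueMate.existsUnique_perfect {G : SimpleGraph V} {f : V → V} (hf : IsUniqueMate G f)
    {S : Set V} (hS : ∀ x ∈ S, f x ∈ S) (hfix : ∀ x ∈ S, f x ≠ x) :
    ∃! N : Set (Sym2 S), IsPerfectMatchingSet (G.induce S) N := by
  classical
  let r : S → S := fun x => ⟨f x, hS x x.2⟩
  have hr : IsMate (G.induce S) r :=
    ⟨fun x => Subtype.ext (hf.1.1 x), fun x _ => hf.1.2 x (hfix x x.2)⟩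
  refine ⟨mateEdges r, ⟨hr.isMatchingSet, ?_⟩, ?_⟩
  · rw [matVerts_mateEdges hr.1]
    exact Set.eq_univ_of_forall fun x h => hfix x x.2 (congrArg Subtype.val h)
  · rintro N ⟨hN, hNV⟩
    obtain ⟨g, hg, rfl⟩ := hN.exists_mate
    rw [matVerts_mateEdges hg.1, Set.eq_univ_iff_forall] at hNV
    let k : V → V := fun x => if h : x ∈ S then g ⟨x, h⟩ else f x
    have k1 (x : S) : k x = g x := dif_pos x.2
    have k2 (x) (h : x ∉ S) : k x = f x := dif_neg h
    have hk : k = f := by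
      refine hf.2 k ⟨fun x => ?_, fun x hx => ?_⟩ fun x => ?_
      · by_cases h : x ∈ S
        · rw [k1 ⟨x, h⟩, k1, hg.1]
        · rw [k2 x h, k2 _ (notMem_of_closed hf.1.1 hS h), hf.1.1]
      · by_cases h : x ∈ S
        · rw [k1 ⟨x, h⟩]
          exact SimpleGraph.comap_adj.1 (hg.2 ⟨x, h⟩ (hNV _))
        · rw [k2 x h] at hx ⊢
          exact hf.1.2 x hx
      · by_cases h : x ∈ S
        · rw [k1 ⟨x, h⟩]
          exact iff_of_false (fun h' => hNV _ (Subtype.ext h')) (hfix x h)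
        · rw [k2 x h]
    congr 1
    ext x
    rw [← k1, hk]

section Components

variable {G : SimpleGraph V} {S : Set V} {H H' : (G.induce S).ConnectedComponent} {x y : V}

theorem mem_of_mem_compSet (hx : x ∈ compSet G S H) : x ∈ S := hx.1

theorem mem_compSet_mk (hx : x ∈ S) :
    x ∈ compSet G S ((G.induce S).connectedComponentMk ⟨x, hx⟩) := ⟨hx, rfl⟩

theorem eq_of_mem_compSet (hx : x ∈ compSet G S H) (hx' : x ∈ compSet G S H') : H = H' :=
  hx.2.symm.trans hx'.2

theorem mem_compSet_of_adj (hx : x ∈ compSet G S H) (hxy : G.Adj x y) (hy : y ∈ S) :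
    y ∈ compSet G S H :=
  ⟨hy, hx.2 ▸ (SimpleGraph.ConnectedComponent.sound
    (SimpleGraph.Adj.reachable (SimpleGraph.comap_adj.2 hxy))).symm⟩

end Components

/-- A vertex that is not matched by `f` inside `G - A(G)`. -/
def IsExternal (G : SimpleGraph V) (f : V → V) (x : V) : Prop := f x = x ∨ f x ∈ Aset G

theorem IsMate.mem_compSet_of_not_isExternal {G : SimpleGraph V} {f : V → V} {H : DComp G}
    {x : V} (hf : IsMate G f) (hx : x ∈ compSet G (Dset G) H) (hext : ¬ IsExternal G f x) :
    f x ∈ compSet G (Dset G) H := by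
  have hne : f x ≠ x := fun h => hext (.inl h)
  refine mem_compSet_of_adj hx (hf.2 x hne) ?_
  by_contra h
  exact hext (.inr ⟨h, x, mem_of_mem_compSet hx, (hf.2 x hne).symm⟩)

section GallaiEdmonds

variable [Finite V] {G : SimpleGraph V} {f : V → V} {H : DComp G} {x y : V}

theorem mem_mateD_adj_of_mem_Aset {B : Set V} (hB : B ⊆ Aset G) :
    ∀ b ∈ B, b ∉ mateD G ∧ ∃ d ∈ mateD G, G.Adj b d :=
  fun _ hb => Dset_eq_mateD G ▸ hB hb

theorem IsMaxMate.ne_of_notMem (hf : IsMaxMate G f) (hx : x ∉ Dset G) : f x ≠ x :=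
  fun h => hx (Dset_eq_mateD G ▸ ⟨f, hf, h⟩)

theorem IsMaxMate.mem_Dset_of_mem_Aset (hf : IsMaxMate G f) (hx : x ∈ Aset G) :
    f x ∈ Dset G := by
  obtain ⟨h1, h2⟩ := isMaxMate_uncover {x}
    (mem_mateD_adj_of_mem_Aset (Set.singleton_subset_iff.2 hx))
  have h3 : f x ∈ mateD (isolate G {x}) :=
    ⟨_, h1 f hf, uncover_of_mem (.inr (by rw [hf.1.1]; rfl))⟩
  rw [Dset_eq_mateD]
  exact (h2 h3).resolve_right (hf.ne_of_notMem hx.1)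

theorem IsMaxMate.mem_Cset (hf : IsMaxMate G f) (hx : x ∈ Cset G) : f x ∈ Cset G := by
  refine ⟨fun h => hx.2 ⟨hx.1, f x, h, hf.1.2 x (hf.ne_of_notMem hx.1)⟩, fun h => hx.1 ?_⟩
  have := hf.mem_Dset_of_mem_Aset h
  rwa [hf.1.1] at this

theorem IsMaxMate.eq_of_isExternal (hf : IsMaxMate G f)
    (hx : x ∈ compSet G (Dset G) H) (hy : y ∈ compSet G (Dset G) H)
    (hxe : IsExternal G f x) (hye : IsExternal G f y) : x = y := by
  obtain ⟨h1, h2⟩ := isMaxMate_uncover (G := G) (Aset G) (mem_mateD_adj_of_mem_Aset subset_rfl)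
  have hfix (z) (hz : IsExternal G f z) : uncover f (Aset G) z = z :=
    hz.elim (uncover_of_fixed _) fun h => uncover_of_mem (.inr h)
  have hsub : Dset G ⊆ mateD (isolate G (Aset G)) := by
    intro d hd
    rw [Dset_eq_mateD] at hd
    obtain ⟨g, hg, hgd⟩ := hd
    exact ⟨_, h1 g hg, uncover_of_fixed _ hgd⟩
  have hinduce : (isolate G (Aset G)).induce (Dset G) = G.induce (Dset G) := by
    ext u v
    exact ⟨fun h => h.1, fun h => ⟨h, fun hu => hu.1 u.2, fun hv => hv.1 v.2⟩⟩
  obtain ⟨hxD, hxH⟩ := hx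
  obtain ⟨hyD, hyH⟩ := hy
  obtain ⟨p⟩ := SimpleGraph.ConnectedComponent.exact (hxH.trans hyH.symm)
  exact congrArg Subtype.val
    ((h1 f hf).eq_of_walk hsub (p.mapLe hinduce.ge) (hfix x hxe) (hfix y hye))

/-- The components of `G[D(G)]` are factor-critical. -/
theorem exists_mate_compSet {h : V} (hh : h ∈ compSet G (Dset G) H) :
    ∃ g, IsMate G g ∧ ∀ x ∈ compSet G (Dset G) H, x ≠ h →
      g x ∈ compSet G (Dset G) H ∧ g x ≠ x ∧ g x ≠ h := by
  obtain ⟨g, hg, hgh⟩ := Dset_eq_mateD G ▸ mem_of_mem_compSet hh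
  refine ⟨g, hg.1, fun x hx hxh => ?_⟩
  have hext : ¬ IsExternal G g x := fun h => hxh (hg.eq_of_isExternal hx hh h (.inl hgh))
  refine ⟨hg.1.mem_compSet_of_not_isExternal hx hext, fun h => hext (.inl h), fun h => hxh ?_⟩
  rw [← hg.1.1 x, h, hgh]

theorem IsMaxMate.exists_isExternal (hf : IsMaxMate G f) (H : DComp G) :
    ∃ h ∈ compSet G (Dset G) H, IsExternal G f h := by
  by_contra! hne
  obtain ⟨⟨h, hD⟩, rfl⟩ := H.exists_rep
  set T := compSet G (Dset G) ((G.induce (Dset G)).connectedComponentMk ⟨h, hD⟩) with hT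
  have hh : h ∈ T := mem_compSet_mk hD
  obtain ⟨g, hg, hgT⟩ := exists_mate_compSet hh
  have h1 : Even T.ncard := even_ncard_of_involution hf.1.1 (Set.toFinite _)
    (fun x hx => hf.1.mem_compSet_of_not_isExternal hx (hne x hx))
    (fun x hx h => hne x hx (.inl h))
  have h2 : Even (T \ {h}).ncard := even_ncard_of_involution hg.1 (Set.toFinite _)
    (fun x hx => ⟨(hgT x hx.1 hx.2).1, (hgT x hx.1 hx.2).2.2⟩)
    (fun x hx => (hgT x hx.1 hx.2).2.1)
  have h3 := Set.ncard_sdiff_singleton_add_one hh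
  rw [← h3] at h1
  exact (Nat.even_add_one.1 h1) h2

theorem IsMaxMate.mem_compSet_sdiff (hf : IsMaxMate G f) {h : V}
    (hh : h ∈ compSet G (Dset G) H) (hext : IsExternal G f h)
    (hx : x ∈ compSet G (Dset G) H \ {h}) :
    f x ∈ compSet G (Dset G) H \ {h} ∧ f x ≠ x := by
  have hxe : ¬ IsExternal G f x := fun h' => hx.2 (hf.eq_of_isExternal hx.1 hh h' hext)
  refine ⟨⟨hf.1.mem_compSet_of_not_isExternal hx.1 hxe, ?_⟩, fun h' => hxe (.inl h')⟩
  rintro (rfl : f x = h)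
  rcases hext with h' | h'
  · exact hxe (.inl (h'.symm.trans (hf.1.1 x)))
  · rw [hf.1.1] at h'
    exact h'.1 (mem_of_mem_compSet hx.1)

theorem IsMaxMate.uniquePMminus (hf : IsMaxMate G f) (huf : IsUniqueMate G f) {h : V}
    (hh : h ∈ compSet G (Dset G) H) (hext : IsExternal G f h) :
    UniquePMminus G (compSet G (Dset G) H) h :=
  huf.existsUnique_perfect (fun _ hx => (hf.mem_compSet_sdiff hh hext hx).1)
    (fun _ hx => (hf.mem_compSet_sdiff hh hext hx).2)

/-- If the vertices of `A(G)` are rematched injectively into the components of `G[D(G)]`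
to which they are matched by a uniquely restricted maximum matching, then nothing changes. -/
theorem IsMaxMate.eq_of_rematch (hf : IsMaxMate G f) (huf : IsUniqueMate G f)
    (c : Aset G → DComp G) (hc : Function.Injective c) (d : Aset G → V)
    (hd : ∀ a, d a ∈ compSet G (Dset G) (c a)) (hadj : ∀ a : Aset G, G.Adj a (d a))
    (hrange : ∀ H, (∃ a, c a = H) ↔ ∃ a : Aset G, f a ∈ compSet G (Dset G) H) (a : Aset G) :
    d a = f a := by
  classical
  choose φ hφ hφd using fun a => exists_mate_compSet (hd a)
  let k : V → V := fun x =>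
    if hA : x ∈ Aset G then d ⟨x, hA⟩
    else if hx : ∃ a, x ∈ compSet G (Dset G) (c a) then
      if x = d hx.choose then hx.choose else φ hx.choose x
    else f x
  have k1 (a : Aset G) : k a = d a := dif_pos a.2
  have notA {x : V} {H : DComp G} (hx : x ∈ compSet G (Dset G) H) : x ∉ Aset G :=
    fun h => h.1 (mem_of_mem_compSet hx)
  have k2 (a x) (hx : x ∈ compSet G (Dset G) (c a)) : k x = if x = d a then ↑a else φ a x := by
    have hx' : ∃ a, x ∈ compSet G (Dset G) (c a) := ⟨a, hx⟩
    have : hx'.choose = a := hc (eq_of_mem_compSet hx'.choose_spec hx)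
    simp only [k, dif_neg (notA hx), dif_pos hx', this]
  have k2d (a) : k (d a) = a := by rw [k2 a _ (hd a), if_pos rfl]
  have k2φ (a x) (hx : x ∈ compSet G (Dset G) (c a)) (hne : x ≠ d a) : k x = φ a x := by
    rw [k2 a x hx, if_neg hne]
  have k3 (x) (hA : x ∉ Aset G) (hx : ¬ ∃ a, x ∈ compSet G (Dset G) (c a)) : k x = f x := by
    simp only [k, dif_neg hA, dif_neg hx]
  have hmoved (a x) (hx : x ∈ compSet G (Dset G) (c a)) : f x ≠ x := by
    obtain ⟨b, hb⟩ := (hrange _).1 ⟨a, rfl⟩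
    intro h
    have : x = f b := hf.eq_of_isExternal hx hb (.inl h) (.inr (by rw [hf.1.1]; exact b.2))
    refine notA hx (h ▸ ?_)
    rw [this, hf.1.1]
    exact b.2
  have hclosed (x) (hA : x ∉ Aset G) (hx : ¬ ∃ a, x ∈ compSet G (Dset G) (c a)) :
      f x ∉ Aset G ∧ ¬ ∃ a, f x ∈ compSet G (Dset G) (c a) := by
    constructor
    · intro h
      have hD := hf.mem_Dset_of_mem_Aset h
      obtain ⟨a, ha⟩ := (hrange _).2 ⟨⟨f x, h⟩, mem_compSet_mk hD⟩
      have := ha ▸ mem_compSet_mk (G := G) hD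
      rw [hf.1.1] at this
      exact hx ⟨a, this⟩
    · rintro ⟨a, ha⟩
      obtain ⟨b, hb⟩ := (hrange _).1 ⟨a, rfl⟩
      by_cases hext : IsExternal G f (f x)
      · have : f x = f b := hf.eq_of_isExternal ha hb hext (.inr (by rw [hf.1.1]; exact b.2))
        have : x = b := by rw [← hf.1.1 x, this, hf.1.1]
        exact hA (this ▸ b.2)
      · have := hf.1.mem_compSet_of_not_isExternal ha hext
        rw [hf.1.1] at this
        exact hx ⟨a, this⟩
  have hk : IsMate G k := by
    refine ⟨fun x => ?_, fun x hx => ?_⟩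
    · by_cases hA : x ∈ Aset G
      · rw [k1 ⟨x, hA⟩, k2d]
      by_cases hxc : ∃ a, x ∈ compSet G (Dset G) (c a)
      · obtain ⟨a, ha⟩ := hxc
        by_cases hxd : x = d a
        · rw [hxd, k2d, k1]
        · have := hφd a x ha hxd
          rw [k2φ a x ha hxd, k2φ a _ this.1 this.2.2, (hφ a).1]
      · rw [k3 x hA hxc, k3 _ (hclosed x hA hxc).1 (hclosed x hA hxc).2, hf.1.1]
    · by_cases hA : x ∈ Aset G
      · rw [k1 ⟨x, hA⟩]
        exact hadj ⟨x, hA⟩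
      by_cases hxc : ∃ a, x ∈ compSet G (Dset G) (c a)
      · obtain ⟨a, ha⟩ := hxc
        by_cases hxd : x = d a
        · rw [hxd, k2d]
          exact (hadj a).symm
        · rw [k2φ a x ha hxd]
          exact (hφ a).2 x (hφd a x ha hxd).2.1
      · rw [k3 x hA hxc] at hx ⊢
        exact hf.1.2 x hx
  have : k = f := by
    refine huf.2 k hk fun x => ?_
    by_cases hA : x ∈ Aset G
    · rw [k1 ⟨x, hA⟩]
      exact iff_of_false (hadj ⟨x, hA⟩).ne' (hf.ne_of_notMem hA.1)
    by_cases hxc : ∃ a, x ∈ compSet G (Dset G) (c a)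
    · obtain ⟨a, ha⟩ := hxc
      refine iff_of_false ?_ (hmoved a x ha)
      by_cases hxd : x = d a
      · rw [hxd, k2d]
        exact (hadj a).ne
      · rw [k2φ a x ha hxd]
        exact (hφd a x ha hxd).2.1
    · rw [k3 x hA hxc]
  rw [← k1, this]

end GallaiEdmonds

theorem GB_adj_inl_inr {G : SimpleGraph V} {a : Aset G} {H : DComp G} :
    (GB G).Adj (.inl a) (.inr H) ↔ ∃ d ∈ compSet G (Dset G) H, G.Adj a d := by
  rw [GB, SimpleGraph.fromRel_adj]
  constructor
  · rintro ⟨-, ⟨b, K, h1, h2, h⟩ | ⟨b, K, h1, h2, h⟩⟩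
    · cases h1; cases h2; exact h
    · cases h1
  · exact fun h => ⟨Sum.inl_ne_inr, .inl ⟨a, H, rfl, rfl, h⟩⟩

theorem exists_of_mem_edgeSet_GB {G : SimpleGraph V} {e : Sym2 (Aset G ⊕ DComp G)}
    (he : e ∈ (GB G).edgeSet) : ∃ a H, e = s(Sum.inl a, Sum.inr H) := by
  induction e with
  | _ x y =>
  rw [SimpleGraph.mem_edgeSet, GB, SimpleGraph.fromRel_adj] at he
  obtain ⟨-, ⟨a, H, rfl, rfl, -⟩ | ⟨a, H, rfl, rfl, -⟩⟩ := he
  · exact ⟨a, H, rfl⟩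
  · exact ⟨a, H, Sym2.eq_swap⟩

section ComponentMatching

variable {G : SimpleGraph V} (c : Aset G → DComp G)

/-- The edge set `{a c(a) | a ∈ A(G)}` of `G_B`. -/
def componentEdges : Set (Sym2 (Aset G ⊕ DComp G)) :=
  Set.range fun a => s(Sum.inl a, Sum.inr (c a))

theorem inl_mem_matVerts_componentEdges (a : Aset G) :
    Sum.inl a ∈ matVerts (componentEdges c) :=
  ⟨_, ⟨a, rfl⟩, Sym2.mem_mk_left _ _⟩

theorem inr_mem_matVerts_componentEdges_iff {c : Aset G → DComp G} {H : DComp G} :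
    Sum.inr H ∈ matVerts (componentEdges c) ↔ ∃ a, c a = H := by
  constructor
  · rintro ⟨_, ⟨a, rfl⟩, h⟩
    simp only [Sym2.mem_iff, reduceCtorEq, Sum.inr.injEq, false_or] at h
    exact ⟨a, h.symm⟩
  · rintro ⟨a, rfl⟩
    exact ⟨_, ⟨a, rfl⟩, Sym2.mem_mk_right _ _⟩

variable {c}

theorem isMatchingSet_componentEdges (hc : Function.Injective c)
    (hadj : ∀ a, ∃ d ∈ compSet G (Dset G) (c a), G.Adj a d) :
    IsMatchingSet (GB G) (componentEdges c) := by
  constructor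
  · rintro _ ⟨a, rfl⟩
    exact GB_adj_inl_inr.2 (hadj a)
  · rintro _ ⟨a, rfl⟩ _ ⟨b, rfl⟩ hne v hv hv'
    refine hne ?_
    suffices a = b by rw [this]
    rcases Sym2.mem_iff.1 hv with rfl | rfl
    · simpa using hv'
    · exact hc (by simpa using hv')

theorem isMaximumMatching_componentEdges [Finite V] (hc : Function.Injective c)
    (hadj : ∀ a, ∃ d ∈ compSet G (Dset G) (c a), G.Adj a d) :
    IsMaximumMatching (GB G) (componentEdges c) := by
  refine ⟨isMatchingSet_componentEdges hc hadj, fun N hN => ?_⟩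
  have h1 : (componentEdges c).ncard = Nat.card (Aset G) := by
    rw [componentEdges, ← Set.image_univ, Set.ncard_image_of_injective, Set.ncard_univ]
    intro a b hab
    have : a = b ∧ c a = c b := by simpa using hab
    exact this.1
  have key (e : N) : ∃ a : Aset G, Sum.inl a ∈ e.1 := by
    obtain ⟨a, H, h⟩ := exists_of_mem_edgeSet_GB (hN.1 e.2)
    exact ⟨a, h ▸ Sym2.mem_mk_left _ _⟩
  choose α hα using key
  rw [h1, ← Nat.card_coe_set_eq]
  refine Nat.card_le_card_of_injective α fun e₁ e₂ h => Subtype.ext ?_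
  by_contra hne
  exact hN.2 _ e₁.2 _ e₂.2 hne _ (hα e₁) (h ▸ hα e₂)

/-- Every matching of `G_B` covering `A(G)` comes from an injection into the components. -/
theorem IsMatchingSet.exists_componentEdges {N : Set (Sym2 (Aset G ⊕ DComp G))}
    (hN : IsMatchingSet (GB G) N) (hA : ∀ a, Sum.inl a ∈ matVerts N) :
    ∃ c : Aset G → DComp G, Function.Injective c ∧ N = componentEdges c ∧
      ∀ a, ∃ d ∈ compSet G (Dset G) (c a), G.Adj a d := by
  have key (a : Aset G) : ∃ H, s(Sum.inl a, Sum.inr H) ∈ N := by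
    obtain ⟨e, he, ha⟩ := hA a
    obtain ⟨b, H, rfl⟩ := exists_of_mem_edgeSet_GB (hN.1 he)
    obtain rfl : a = b := by simpa using ha
    exact ⟨H, he⟩
  choose c hc using key
  refine ⟨c, fun a b h => ?_, ?_, fun a => GB_adj_inl_inr.1 (hN.1 (hc a))⟩
  · have ha := hc a
    have hb := hc b
    rw [Sym2.eq_swap] at ha hb
    exact Sum.inl_injective (hN.eq_of_mem ha (h ▸ hb))
  · ext e
    constructor
    · intro he
      obtain ⟨a, H, rfl⟩ := exists_of_mem_edgeSet_GB (hN.1 he)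
      exact ⟨a, by rw [hN.eq_of_mem he (hc a)]⟩
    · rintro ⟨a, rfl⟩
      exact hc a

end ComponentMatching

/-- Necessity: if some maximum matching of `G` is uniquely restricted, then
conditions (i)–(iii) of the characterization hold. -/
theorem stmt17 [Fintype V] (G : SimpleGraph V)
    (M : Set (Sym2 V)) (hM : IsMaximumMatching G M) (hur : UniquelyRestricted G M) :
    (∀ H : (G.induce (Cset G)).ConnectedComponent,
      ∃! N : Set (Sym2 ↥(compSet G (Cset G) H)),
        IsPerfectMatchingSet (G.induce (compSet G (Cset G) H)) N) ∧
    (∀ H : DComp G, ∃ h ∈ compSet G (Dset G) H,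
        UniquePMminus G (compSet G (Dset G) H) h) ∧
    (∃ MB, IsMaximumMatching (GB G) MB ∧ UniquelyRestricted (GB G) MB ∧
      ∀ e ∈ MB, ∃ (a : ↥(Aset G)) (H : DComp G) (h : V),
        e = s(Sum.inl a, Sum.inr H) ∧ h ∈ compSet G (Dset G) H ∧ G.Adj a.1 h ∧
        (∀ d ∈ compSet G (Dset G) H, G.Adj a.1 d → d = h) ∧
        UniquePMminus G (compSet G (Dset G) H) h) := by
  classical
  obtain ⟨f, hf', rfl⟩ := hM.1.exists_mate
  have hf : IsMaxMate G f := (isMaximumMatching_mateEdges_iff hf').1 hM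
  have huf : IsUniqueMate G f := hur.isUniqueMate hf'
  refine ⟨fun H => huf.existsUnique_perfect (fun x hx => ?_)
      fun x hx => hf.ne_of_notMem (mem_of_mem_compSet hx).1, fun H => ?_, ?_⟩
  · have hC := mem_of_mem_compSet hx
    exact mem_compSet_of_adj hx (hf.1.2 x (hf.ne_of_notMem hC.1)) (hf.mem_Cset hC)
  · obtain ⟨h, hh, hext⟩ := hf.exists_isExternal H
    exact ⟨h, hh, hf.uniquePMminus huf hh hext⟩
  let c : Aset G → DComp G := fun a =>
    (G.induce (Dset G)).connectedComponentMk ⟨f a, hf.mem_Dset_of_mem_Aset a.2⟩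
  have hfc (a : Aset G) : f a ∈ compSet G (Dset G) (c a) := mem_compSet_mk _
  have hfadj (a : Aset G) : G.Adj a (f a) := hf.1.2 a (hf.ne_of_notMem a.2.1)
  have hext (a : Aset G) : IsExternal G f (f a) := .inr (by rw [hf.1.1]; exact a.2)
  have hc : Function.Injective c := by
    intro a b h
    have := hf.eq_of_isExternal (hfc a) (h ▸ hfc b) (hext a) (hext b)
    exact Subtype.ext (by rw [← hf.1.1 a, this, hf.1.1])
  have hrange (H : DComp G) :
      (∃ a, c a = H) ↔ ∃ a : Aset G, f a ∈ compSet G (Dset G) H := by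
    refine exists_congr fun a => ⟨?_, eq_of_mem_compSet (hfc a)⟩
    rintro rfl
    exact hfc a
  have hcadj (a : Aset G) : ∃ d ∈ compSet G (Dset G) (c a), G.Adj a d := ⟨_, hfc a, hfadj a⟩
  refine ⟨componentEdges c, isMaximumMatching_componentEdges hc hcadj, fun N hN hNV => ?_, ?_⟩
  · obtain ⟨c', hc', rfl, hadj'⟩ := hN.exists_componentEdges
      fun a => hNV ▸ inl_mem_matVerts_componentEdges c a
    choose d hd hda using hadj'
    have key := hf.eq_of_rematch huf c' hc' d hd hda fun H => by
      rw [← hrange, ← inr_mem_matVerts_componentEdges_iff, hNV,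
        inr_mem_matVerts_componentEdges_iff]
    congr 1
    ext1 a
    exact eq_of_mem_compSet (hd a) (key a ▸ hfc a)
  · rintro _ ⟨a, rfl⟩
    refine ⟨a, c a, f a, rfl, hfc a, hfadj a, fun d hd hda => ?_,
      hf.uniquePMminus huf (hfc a) (hext a)⟩
    have key := hf.eq_of_rematch huf c hc (Function.update (fun b => f b) a d)
      (fun b => ?_) (fun b => ?_) hrange a
    · simpa using key
    · by_cases h : b = a
      · subst h; simpa using hd
      · simpa [h] using hfc b
    · by_cases h : b = a
      · subst h; simpa using hda
      · simpa [h] using hfadj b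
end

section
/- Let G be a graph with Gallai–Edmonds decomposition D(G), A(G), C(G) and associated bipartite graph G_B. Every maximum matching in G is uniquely restricted if and only if: (i) every component of G[C(G)] has a unique perfect matching; (ii) for every component H of G[D(G)], every near-perfect matching of H is uniquely restricted; (iii) every maximum matching of G_B is uniquely restricted; and (iv) whenever an edge aH of G_B (a ∈ A(G), H a component of G[D(G)]) lies in some maximum matching of G_B, the vertex a has a unique neighbor in V(H). -/
variable {V : Type*}

namespace SimpleGraph

open Function

variable {W : Type*} {G : SimpleGraph W} {m n : W → W}

/-- A matching of `G`, encoded as the involution that swaps the ends of each matching edge and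
fixes the uncovered vertices. -/
def IsMatchingMap (G : SimpleGraph W) (m : W → W) : Prop :=
  (∀ v, m (m v) = v) ∧ ∀ v, m v ≠ v → G.Adj v (m v)

/-- A matching map with the fewest uncovered vertices. -/
def IsMaximumMap (G : SimpleGraph W) (m : W → W) : Prop :=
  IsMatchingMap G m ∧
    ∀ n, IsMatchingMap G n → (fixedPoints m).ncard ≤ (fixedPoints n).ncard

/-- The set of edges of the matching encoded by `m`. -/
def mapEdges (m : W → W) : Set (Sym2 W) :=
  {e | ∃ v, m v ≠ v ∧ s(v, m v) = e}

/-! ### Matchings as sets of edges and as involutions -/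

lemma IsMatchingMap.mk_mem_mapEdges (hm : IsMatchingMap G m) {u v : W} :
    s(u, v) ∈ mapEdges m ↔ u ≠ v ∧ m u = v := by
  have := hm.1
  simp only [mapEdges, Set.mem_ofPred_eq, Sym2.eq_iff]
  grind

lemma IsMatchingMap.isMatchingSet (hm : IsMatchingMap G m) :
    IsMatchingSet G (mapEdges m) := by
  refine ⟨?_, ?_⟩
  · rintro _ ⟨v, hv, rfl⟩
    exact hm.2 v hv
  · rintro _ ⟨v, hv, rfl⟩ _ ⟨w, hw, rfl⟩ hne x hx hx'
    have := hm.1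
    simp only [Sym2.mem_iff] at hx hx'
    apply hne
    rw [Sym2.eq_iff]
    grind

lemma IsMatchingMap.matVerts_mapEdges (hm : IsMatchingMap G m) :
    matVerts (mapEdges m) = (fixedPoints m)ᶜ := by
  ext x
  simp only [matVerts, Set.mem_ofPred_eq, Set.mem_compl_iff, mem_fixedPoints_iff]
  constructor
  · rintro ⟨_, ⟨v, hv, rfl⟩, hx⟩
    have := hm.1
    simp only [Sym2.mem_iff] at hx
    grind
  · intro hx
    exact ⟨_, ⟨x, hx, rfl⟩, by simp⟩

lemma IsMatchingMap.mapEdges_inj (hm : IsMatchingMap G m) (hn : IsMatchingMap G n)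
    (h : mapEdges m = mapEdges n) : m = n := by
  funext v
  have h1 : ∀ u w, s(u, w) ∈ mapEdges m ↔ s(u, w) ∈ mapEdges n := by simp [h]
  simp only [hm.mk_mem_mapEdges, hn.mk_mem_mapEdges] at h1
  have := h1 v (m v)
  have := h1 v (n v)
  grind

open Classical in
lemma exists_isMatchingMap {M : Set (Sym2 W)} (hM : IsMatchingSet G M) :
    ∃ m, IsMatchingMap G m ∧ mapEdges m = M := by
  have huniq : ∀ {u v w}, s(u, v) ∈ M → s(u, w) ∈ M → v = w := by
    intro u v w hv hw
    by_contra hne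
    refine hM.2 _ hv _ hw ?_ u (by simp) (by simp)
    rw [Ne, Sym2.eq_iff]
    grind
  let m : W → W := fun v => if h : ∃ w, s(v, w) ∈ M then h.choose else v
  have hm : ∀ {u v}, s(u, v) ∈ M → m u = v := by
    intro u v huv
    have h : ∃ w, s(u, w) ∈ M := ⟨v, huv⟩
    simp only [m, dif_pos h]
    exact huniq h.choose_spec huv
  have hm' : ∀ {u}, (¬ ∃ w, s(u, w) ∈ M) → m u = u := by
    intro u h
    simp only [m, dif_neg h]
  have hmem : ∀ u, m u ≠ u → s(u, m u) ∈ M := by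
    intro u hu
    by_cases h : ∃ w, s(u, w) ∈ M
    · obtain ⟨w, hw⟩ := h
      rwa [hm hw]
    · exact absurd (hm' h) hu
  refine ⟨m, ⟨fun v => ?_, fun v hv => hM.1 (hmem v hv)⟩, ?_⟩
  · by_cases h : m v = v
    · rw [h, h]
    · exact hm (by rw [Sym2.eq_swap]; exact hmem v h)
  · ext e
    constructor
    · rintro ⟨v, hv, rfl⟩
      exact hmem v hv
    · induction e with | _ u v =>
      intro he
      have hne : u ≠ v := G.ne_of_adj (hM.1 he)
      exact ⟨u, by rw [hm he]; exact hne.symm, by rw [hm he]⟩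

lemma IsMatchingMap.two_mul_ncard_add [Finite W] (hm : IsMatchingMap G m) :
    2 * (mapEdges m).ncard + (fixedPoints m).ncard = Nat.card W := by
  classical
  have := Fintype.ofFinite W
  have h1 := hm.1
  have hE : ((fixedPoints m)ᶜ).ncard = 2 * (mapEdges m).ncard := by
    rw [Set.ncard_eq_toFinset_card', Set.ncard_eq_toFinset_card',
      Finset.card_eq_sum_card_fiberwise (f := fun v => s(v, m v)) (t := (mapEdges m).toFinset)]
    · rw [Finset.sum_const_nat (m := 2), mul_comm]
      intro e he
      obtain ⟨v, hv, rfl⟩ := Set.mem_toFinset.mp he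
      rw [Finset.card_eq_two]
      refine ⟨v, m v, hv.symm, ?_⟩
      ext x
      simp only [Finset.mem_filter, Set.mem_toFinset, Set.mem_compl_iff, mem_fixedPoints_iff,
        Sym2.eq_iff, Finset.mem_insert, Finset.mem_singleton]
      grind
    · intro v hv
      simp only [Finset.mem_coe, Set.mem_toFinset, Set.mem_compl_iff, mem_fixedPoints_iff] at hv ⊢
      exact ⟨v, hv, rfl⟩
  have := Set.ncard_add_ncard_compl (fixedPoints m)
  lia

lemma IsMatchingMap.isMaximumMatching_iff [Finite W] (hm : IsMatchingMap G m) :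
    IsMaximumMatching G (mapEdges m) ↔ IsMaximumMap G m := by
  have h1 := hm.two_mul_ncard_add
  constructor
  · intro h
    refine ⟨hm, fun n hn => ?_⟩
    have := h.2 _ hn.isMatchingSet
    have := hn.two_mul_ncard_add
    lia
  · intro h
    refine ⟨hm.isMatchingSet, fun N hN => ?_⟩
    obtain ⟨n, hn, rfl⟩ := exists_isMatchingMap hN
    have := h.2 _ hn
    have := hn.two_mul_ncard_add
    lia

/-- Any two matching maps with the same uncovered vertices as `m` agree with `m`. -/
def UniqueMap (G : SimpleGraph W) (m : W → W) : Prop :=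
  ∀ n, IsMatchingMap G n → fixedPoints n = fixedPoints m → n = m

lemma IsMatchingMap.uniquelyRestricted_iff (hm : IsMatchingMap G m) :
    UniquelyRestricted G (mapEdges m) ↔ UniqueMap G m := by
  constructor
  · intro h n hn hnm
    refine hn.mapEdges_inj hm (h _ hn.isMatchingSet ?_)
    rw [hn.matVerts_mapEdges, hm.matVerts_mapEdges, hnm]
  · intro h N hN hNm
    obtain ⟨n, hn, rfl⟩ := exists_isMatchingMap hN
    rw [hn.matVerts_mapEdges, hm.matVerts_mapEdges, compl_inj_iff] at hNm
    rw [h n hn hNm]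

lemma forall_uniquelyRestricted_iff [Finite W] :
    (∀ M, IsMaximumMatching G M → UniquelyRestricted G M) ↔
      ∀ m, IsMaximumMap G m → UniqueMap G m := by
  constructor
  · intro h m hm
    exact hm.1.uniquelyRestricted_iff.mp (h _ (hm.1.isMaximumMatching_iff.mpr hm))
  · intro h M hM
    obtain ⟨m, hm, rfl⟩ := exists_isMatchingMap hM.1
    exact hm.uniquelyRestricted_iff.mpr (h m (hm.isMaximumMatching_iff.mp hM))

lemma mem_Dset_iff [Finite W] {v : W} : v ∈ Dset G ↔ ∃ m, IsMaximumMap G m ∧ m v = v := by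
  constructor
  · rintro ⟨M, hM, hv⟩
    obtain ⟨m, hm, rfl⟩ := exists_isMatchingMap hM.1
    rw [hm.matVerts_mapEdges] at hv
    exact ⟨m, hm.isMaximumMatching_iff.mp hM, by simpa [IsFixedPt] using hv⟩
  · rintro ⟨m, hm, hv⟩
    refine ⟨_, hm.1.isMaximumMatching_iff.mpr hm, ?_⟩
    rw [hm.1.matVerts_mapEdges]
    simpa [IsFixedPt] using hv

lemma exists_isMaximumMap (G : SimpleGraph W) : ∃ m, IsMaximumMap G m := by
  obtain ⟨m, hm, hmin⟩ := exists_minimalFor_of_wellFoundedLT (IsMatchingMap G)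
    (fun m => (fixedPoints m).ncard) ⟨id, fun _ => rfl, fun _ h => absurd rfl h⟩
  refine ⟨m, hm, fun n hn => ?_⟩
  by_contra h
  exact h (hmin hn (by lia))

lemma IsMaximumMap.of_ncard_le (hm : IsMaximumMap G m) (hn : IsMatchingMap G n)
    (h : (fixedPoints n).ncard ≤ (fixedPoints m).ncard) : IsMaximumMap G n :=
  ⟨hn, fun k hk => h.trans (hm.2 k hk)⟩

lemma IsMaximumMap.ncard_eq (hm : IsMaximumMap G m) (hn : IsMaximumMap G n) :
    (fixedPoints m).ncard = (fixedPoints n).ncard :=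
  le_antisymm (hm.2 n hn.1) (hn.2 m hm.1)

/-! ### Exchanging an edge -/

open Classical in
/-- Match the uncovered vertex `w` to `y`, releasing the former partner of `y`. -/
noncomputable def exchange (m : W → W) (w y : W) : W → W := fun v =>
  if v = w then y else if v = y then w else if v = m y then v else m v

lemma IsMatchingMap.exchange (hm : IsMatchingMap G m) {w y : W} (hw : m w = w)
    (hwy : G.Adj w y) : IsMatchingMap G (exchange m w y) := by
  have h1 := hm.1
  have h2 := hm.2
  have h3 := hwy.symm
  have h4 := hwy.ne
  refine ⟨fun v => ?_, fun v => ?_⟩ <;> simp only [SimpleGraph.exchange] <;> grind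

lemma IsMatchingMap.fixedPoints_exchange_of_fixed (hm : IsMatchingMap G m) {w y : W}
    (hwy : w ≠ y) (hy : m y = y) :
    fixedPoints (SimpleGraph.exchange m w y) = fixedPoints m \ {w, y} := by
  have h1 := hm.1
  ext v
  simp only [mem_fixedPoints_iff, Set.mem_sdiff, Set.mem_insert_iff, Set.mem_singleton_iff,
    SimpleGraph.exchange]
  grind

lemma IsMatchingMap.fixedPoints_exchange (hm : IsMatchingMap G m) {w y : W}
    (hw : m w = w) (hwy : w ≠ y) (hy : m y ≠ y) :
    fixedPoints (SimpleGraph.exchange m w y) = insert (m y) (fixedPoints m \ {w}) := by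
  have h1 := hm.1
  ext v
  simp only [mem_fixedPoints_iff, Set.mem_sdiff, Set.mem_insert_iff, Set.mem_singleton_iff,
    SimpleGraph.exchange]
  grind

lemma IsMatchingMap.ncard_fixedPoints_exchange_of_fixed [Finite W] (hm : IsMatchingMap G m)
    {w y : W} (hw : m w = w) (hwy : w ≠ y) (hy : m y = y) :
    (fixedPoints (SimpleGraph.exchange m w y)).ncard + 2 = (fixedPoints m).ncard := by
  rw [hm.fixedPoints_exchange_of_fixed hwy hy, ← Set.ncard_pair hwy]
  refine Set.ncard_sdiff_add_ncard_of_subset ?_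
  rintro v (rfl | rfl) <;> simpa [IsFixedPt]

lemma IsMatchingMap.ncard_fixedPoints_exchange [Finite W] (hm : IsMatchingMap G m)
    {w y : W} (hw : m w = w) (hwy : w ≠ y) (hy : m y ≠ y) :
    (fixedPoints (SimpleGraph.exchange m w y)).ncard = (fixedPoints m).ncard := by
  have h1 := hm.1
  rw [hm.fixedPoints_exchange hw hwy hy, Set.ncard_insert_of_notMem,
    Set.ncard_sdiff_singleton_add_one]
  · simpa [IsFixedPt]
  · simp only [Set.mem_sdiff, mem_fixedPoints_iff]
    grind

lemma IsMatchingMap.ncard_exchange_ne_lt [Finite W] (hm : IsMatchingMap G m)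
    (hn : IsMatchingMap G n) {w : W} (hw : m w = w) (hnw : n w ≠ w) :
    {v | SimpleGraph.exchange m w (n w) v ≠ n v}.ncard < {v | m v ≠ n v}.ncard := by
  have h1 := hm.1
  have h2 := hn.1
  refine Set.ncard_lt_ncard (Set.ssubset_iff_of_subset ?_ |>.mpr ⟨w, ?_, ?_⟩)
  · intro v
    simp only [Set.mem_ofPred_eq, SimpleGraph.exchange]
    grind
  · simp only [Set.mem_ofPred_eq]
    grind
  · simp [SimpleGraph.exchange]

lemma IsMaximumMap.ne_of_adj [Finite W] (hm : IsMaximumMap G m) {w y : W} (hw : m w = w)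
    (hwy : G.Adj w y) : m y ≠ y := by
  intro hy
  have := hm.2 _ (hm.1.exchange hw hwy)
  have := hm.1.ncard_fixedPoints_exchange_of_fixed hw hwy.ne hy
  lia

lemma IsMaximumMap.exchange [Finite W] (hm : IsMaximumMap G m) {w y : W} (hw : m w = w)
    (hwy : G.Adj w y) : IsMaximumMap G (exchange m w y) :=
  hm.of_ncard_le (hm.1.exchange hw hwy)
    (hm.1.ncard_fixedPoints_exchange hw hwy.ne (hm.ne_of_adj hw hwy)).le

/-- **Gallai's lemma**: not being simultaneously missable is transitive on `D(G)`. -/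
lemma IsMaximumMap.false_of_fixed_pair [Finite W] {u v w : W}
    (huv : ∀ m, IsMaximumMap G m → m u = u → m v ≠ v)
    (hvw : ∀ m, IsMaximumMap G m → m v = v → m w ≠ w) (huw : u ≠ w)
    (hm : IsMaximumMap G m) (hu : m u = u) (hw : m w = w)
    (hn : IsMaximumMap G n) (hv : n v = v) : False := by
  induction hk : {x | n x ≠ m x}.ncard using Nat.strong_induction_on generalizing n with
  | _ k ih =>
  have hnu : n u ≠ u := fun h => huv n hn h hv
  have hnw : n w ≠ w := hvw n hn hv
  have hcard : 1 < (fixedPoints n \ fixedPoints m).ncard := by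
    have h1 := Set.ncard_inter_add_ncard_sdiff_eq_ncard (fixedPoints n) (fixedPoints m)
    have h2 := Set.ncard_inter_add_ncard_sdiff_eq_ncard (fixedPoints m) (fixedPoints n)
    rw [Set.inter_comm] at h2
    have h3 := hm.ncard_eq hn
    have h4 : ({u, w} : Set W).ncard ≤ (fixedPoints m \ fixedPoints n).ncard := by
      refine Set.ncard_le_ncard ?_
      rintro x (rfl | rfl) <;> simp [IsFixedPt, *]
    rw [Set.ncard_pair huw] at h4
    lia
  obtain ⟨x, ⟨hxn, hxm⟩, hxv⟩ := Set.exists_ne_of_one_lt_ncard hcard v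
  rw [mem_fixedPoints_iff] at hxn hxm
  have hadj := hm.1.2 x hxm
  refine ih _ (hk ▸ hn.1.ncard_exchange_ne_lt hm.1 hxn hxm) (hn.exchange hxn hadj) ?_ rfl
  have : v ∈ fixedPoints (SimpleGraph.exchange n x (m x)) := by
    rw [hn.1.fixedPoints_exchange hxn hadj.ne (hn.ne_of_adj hxn hadj)]
    exact Or.inr ⟨hv, fun h => hxv h.symm⟩
  exact this


/-! ### Deleting a vertex of `A(G)` -/

open Classical in
/-- Remove the edge covering `a`. -/
noncomputable def unmatch (m : W → W) (a : W) : W → W := fun v =>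
  if v = a ∨ v = m a then v else m v

lemma IsMatchingMap.unmatch (hm : IsMatchingMap G m) (a : W) :
    IsMatchingMap (G.deleteIncidenceSet a) (unmatch m a) := by
  have h1 := hm.1
  refine ⟨fun v => ?_, fun v hv => ?_⟩
  · simp only [SimpleGraph.unmatch]
    grind
  · rw [deleteIncidenceSet_adj]
    have h2 := hm.2 v
    simp only [SimpleGraph.unmatch] at hv ⊢
    grind

lemma IsMatchingMap.ncard_fixedPoints_unmatch [Finite W] (hm : IsMatchingMap G m) {a : W}
    (ha : m a ≠ a) :
    (fixedPoints (SimpleGraph.unmatch m a)).ncard = (fixedPoints m).ncard + 2 := by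
  have h1 := hm.1
  have : fixedPoints (SimpleGraph.unmatch m a) = insert a (insert (m a) (fixedPoints m)) := by
    ext v
    simp only [mem_fixedPoints_iff, Set.mem_insert_iff, SimpleGraph.unmatch]
    grind
  rw [this, Set.ncard_insert_of_notMem, Set.ncard_insert_of_notMem]
  · rw [mem_fixedPoints_iff]
    grind
  · simp only [Set.mem_insert_iff, mem_fixedPoints_iff]
    grind

lemma IsMatchingMap.of_deleteIncidenceSet {a : W}
    (hm : IsMatchingMap (G.deleteIncidenceSet a) m) : IsMatchingMap G m ∧ m a = a := by
  refine ⟨⟨hm.1, fun v hv => ?_⟩, ?_⟩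
  · exact (deleteIncidenceSet_adj.mp (hm.2 v hv)).1
  · by_contra h
    exact (deleteIncidenceSet_adj.mp (hm.2 a h)).2.1 rfl

lemma IsMaximumMap.ne_of_notMem_Dset [Finite W] (hm : IsMaximumMap G m) {v : W}
    (hv : v ∉ Dset G) : m v ≠ v :=
  fun h => hv (mem_Dset_iff.mpr ⟨m, hm, h⟩)

lemma IsMaximumMap.unmatch [Finite W] (hm : IsMaximumMap G m) {a : W} (ha : a ∉ Dset G) :
    IsMaximumMap (G.deleteIncidenceSet a) (unmatch m a) := by
  refine ⟨hm.1.unmatch a, fun k hk => ?_⟩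
  obtain ⟨hkG, hka⟩ := hk.of_deleteIncidenceSet
  rw [hm.1.ncard_fixedPoints_unmatch (hm.ne_of_notMem_Dset ha)]
  by_contra hlt
  have h1 := hm.2 k hkG
  have h2 := hm.1.two_mul_ncard_add
  have h3 := hkG.two_mul_ncard_add
  exact (hm.of_ncard_le hkG (by lia)).ne_of_notMem_Dset ha hka

lemma IsMaximumMap.false_of_deficient [Finite W] {a x d : W} (hn : IsMaximumMap G n)
    (hd : n d = d) (had : G.Adj a d) (ha : a ∉ Dset G) (hx : x ∉ Dset G) (hxa : x ≠ a)
    (hm : IsMatchingMap G m) (hma : m a = a) (hmx : m x = x)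
    (hcard : (fixedPoints m).ncard = (fixedPoints n).ncard + 2) : False := by
  induction hk : {x | m x ≠ n x}.ncard using Nat.strong_induction_on generalizing m with
  | _ k ih =>
  have hxd : x ≠ d := fun h => hx (h ▸ mem_Dset_iff.mpr ⟨n, hn, hd⟩)
  by_cases hmd : m d = d
  · have h1 := hm.ncard_fixedPoints_exchange_of_fixed hma had.ne hmd
    have h2 : IsMaximumMap G (SimpleGraph.exchange m a d) :=
      hn.of_ncard_le (hm.exchange hma had) (by lia)
    have : x ∈ fixedPoints (SimpleGraph.exchange m a d) := by
      rw [hm.fixedPoints_exchange_of_fixed had.ne hmd]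
      exact ⟨hmx, by simp [hxa, hxd]⟩
    exact h2.ne_of_notMem_Dset hx this
  · have h3 : 2 < (fixedPoints m \ fixedPoints n).ncard := by
      have h1 := Set.ncard_inter_add_ncard_sdiff_eq_ncard (fixedPoints m) (fixedPoints n)
      have h2 := Set.ncard_inter_add_ncard_sdiff_eq_ncard (fixedPoints n) (fixedPoints m)
      rw [Set.inter_comm] at h2
      have h3 : 0 < (fixedPoints n \ fixedPoints m).ncard :=
        (Set.ncard_pos).mpr ⟨d, hd, hmd⟩
      lia
    obtain ⟨w, ⟨hwm, hwn⟩, hw⟩ : ∃ w ∈ fixedPoints m \ fixedPoints n, w ∉ ({a, x} : Set W) :=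
      Set.exists_mem_notMem_of_ncard_lt_ncard (by
        have := Set.ncard_insert_le a {x}
        rw [Set.ncard_singleton] at this
        lia)
    rw [mem_fixedPoints_iff] at hwm hwn
    simp only [Set.mem_insert_iff, Set.mem_singleton_iff, not_or] at hw
    have hadj := hn.1.2 w hwn
    by_cases hy : m (n w) = n w
    · have h1 := hm.ncard_fixedPoints_exchange_of_fixed hwm hadj.ne hy
      have h2 : IsMaximumMap G (SimpleGraph.exchange m w (n w)) :=
        hn.of_ncard_le (hm.exchange hwm hadj) (by lia)
      have h4 := hm.fixedPoints_exchange_of_fixed hadj.ne hy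
      by_cases hya : n w = a
      · have : x ∈ fixedPoints (SimpleGraph.exchange m w (n w)) := by
          rw [h4]
          exact ⟨hmx, by simp [hya, hxa, Ne.symm hw.2]⟩
        exact h2.ne_of_notMem_Dset hx this
      · have : a ∈ fixedPoints (SimpleGraph.exchange m w (n w)) := by
          rw [h4]
          exact ⟨hma, by simp [Ne.symm hya, Ne.symm hw.1]⟩
        exact h2.ne_of_notMem_Dset ha this
    · have hfix := hm.fixedPoints_exchange hwm hadj.ne hy
      have key : ∀ z, m z = z → z ≠ w → SimpleGraph.exchange m w (n w) z = z := by
        intro z hz hzw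
        have : z ∈ fixedPoints (SimpleGraph.exchange m w (n w)) := by
          rw [hfix]
          exact Or.inr ⟨hz, hzw⟩
        exact this
      exact ih _ (hk ▸ hm.ncard_exchange_ne_lt hn.1 hwm hwn) (hm.exchange hwm hadj)
        (key a hma (Ne.symm hw.1)) (key x hmx (Ne.symm hw.2))
        (by rw [hm.ncard_fixedPoints_exchange hwm hadj.ne hy, hcard]) rfl

/-- The stability lemma. -/
lemma mem_Dset_deleteIncidenceSet_iff [Finite W] {a v : W} (ha : a ∈ Aset G) :
    v ∈ Dset (G.deleteIncidenceSet a) ↔ v ∈ Dset G ∨ v = a := by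
  obtain ⟨haD, d, hd, had⟩ := ha
  constructor
  · intro hv
    by_contra! hc
    obtain ⟨k, hk, hkv⟩ := mem_Dset_iff.mp hv
    obtain ⟨n, hn, hnd⟩ := mem_Dset_iff.mp hd
    obtain ⟨hkG, hka⟩ := hk.1.of_deleteIncidenceSet
    refine hn.false_of_deficient hnd had haD hc.1 hc.2 hkG hka hkv ?_
    rw [hk.ncard_eq (hn.unmatch haD),
      hn.1.ncard_fixedPoints_unmatch (hn.ne_of_notMem_Dset haD)]
  · rintro (hv | rfl)
    · obtain ⟨n, hn, hnv⟩ := mem_Dset_iff.mp hv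
      exact mem_Dset_iff.mpr ⟨_, hn.unmatch haD, by simp [SimpleGraph.unmatch, hnv]⟩
    · obtain ⟨n, hn⟩ := exists_isMaximumMap G
      exact mem_Dset_iff.mpr ⟨_, hn.unmatch haD, by simp [SimpleGraph.unmatch]⟩

lemma Aset_deleteIncidenceSet [Finite W] {a : W} (ha : a ∈ Aset G) :
    Aset (G.deleteIncidenceSet a) = Aset G \ {a} := by
  ext v
  simp only [Aset, Set.mem_sdiff, Set.mem_ofPred_eq, mem_Dset_deleteIncidenceSet_iff ha,
    deleteIncidenceSet_adj, Set.mem_singleton_iff]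
  have := ha.1
  grind

/-! ### The Gallai–Edmonds structure of maximum matchings -/

lemma IsMaximumMap.apply_mem_Dset [Finite W] (hm : IsMaximumMap G m) {a : W}
    (ha : a ∈ Aset G) : m a ∈ Dset G := by
  have h : m a ∈ Dset (G.deleteIncidenceSet a) :=
    mem_Dset_iff.mpr ⟨_, hm.unmatch ha.1, by simp [SimpleGraph.unmatch]⟩
  exact ((mem_Dset_deleteIncidenceSet_iff ha).mp h).resolve_right (hm.ne_of_notMem_Dset ha.1)

lemma IsMatchingMap.apply_mem_Aset (hm : IsMatchingMap G m) {u : W} (hu : u ∈ Dset G)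
    (hmu : m u ≠ u) (h : m u ∉ Dset G) : m u ∈ Aset G :=
  ⟨h, u, hu, (hm.2 u hmu).symm⟩

lemma ne_of_reflTransGen [Finite W] {u v : W}
    (h : Relation.ReflTransGen (fun x y => x ∈ Dset G ∧ y ∈ Dset G ∧ G.Adj x y) u v)
    (huv : u ≠ v) : ∀ m, IsMaximumMap G m → m u = u → m v ≠ v := by
  induction h with
  | refl => exact absurd rfl huv
  | @tail b c _ hbc ih =>
    obtain ⟨hb, -, hadj⟩ := hbc
    have hbc' : ∀ m, IsMaximumMap G m → m b = b → m c ≠ c := fun m hm hmb => hm.ne_of_adj hmb hadj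
    by_cases hub : u = b
    · exact hub ▸ hbc'
    · intro m hm hmu hmc
      obtain ⟨n, hn, hnb⟩ := mem_Dset_iff.mp hb
      exact hm.false_of_fixed_pair (ih hub) hbc' huv hmu hmc hn hnb

lemma IsMaximumMap.false_of_reflTransGen [Finite W] {u v : W} (hm : IsMaximumMap G m)
    (h : Relation.ReflTransGen (fun x y => x ∈ Dset G ∧ y ∈ Dset G ∧ G.Adj x y) u v)
    (huD : u ∈ Dset G) (hvD : v ∈ Dset G) (huv : u ≠ v) (hu : m u = u ∨ m u ∈ Aset G)
    (hv : m v = v ∨ m v ∈ Aset G) : False := by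
  induction hk : (Aset G).ncard generalizing G m with
  | zero =>
    rw [Set.ncard_eq_zero] at hk
    simp only [hk, Set.mem_empty_iff_false, or_false] at hu hv
    exact ne_of_reflTransGen h huv m hm hu hv
  | succ k ih =>
    obtain ⟨a, ha⟩ : (Aset G).Nonempty := by
      rw [← Set.ncard_pos]
      lia
    have haD := ha.1
    have hAset := Aset_deleteIncidenceSet ha
    have hexit : ∀ x, m x = x ∨ m x ∈ Aset G → SimpleGraph.unmatch m a x = x ∨
        SimpleGraph.unmatch m a x ∈ Aset (G.deleteIncidenceSet a) := by
      intro x hx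
      have := hm.1.1
      rw [hAset]
      simp only [SimpleGraph.unmatch, Set.mem_sdiff, Set.mem_singleton_iff]
      grind
    refine ih (hm.unmatch haD) (Relation.ReflTransGen.mono ?_ _ _ h) ?_ ?_ (hexit u hu) (hexit v hv) ?_
    · rintro x y ⟨hx, hy, hxy⟩
      rw [mem_Dset_deleteIncidenceSet_iff ha, mem_Dset_deleteIncidenceSet_iff ha,
        deleteIncidenceSet_adj]
      exact ⟨Or.inl hx, Or.inl hy, hxy, fun h => haD (h ▸ hx), fun h => haD (h ▸ hy)⟩
    · exact (mem_Dset_deleteIncidenceSet_iff ha).mpr (Or.inl huD)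
    · exact (mem_Dset_deleteIncidenceSet_iff ha).mpr (Or.inl hvD)
    · rw [hAset, Set.ncard_sdiff_singleton_of_mem ha, hk, Nat.add_sub_cancel]

section Components

variable {S : Set W} {H H' : (G.induce S).ConnectedComponent} {u v : W}

lemma mem_of_mem_compSet (hv : v ∈ compSet G S H) : v ∈ S := hv.1

lemma eq_of_mem_compSet (hv : v ∈ compSet G S H) (hv' : v ∈ compSet G S H') : H = H' :=
  hv.2.symm.trans hv'.2

lemma mem_compSet_of_adj (hu : u ∈ compSet G S H) (hv : v ∈ S) (huv : G.Adj u v) :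
    v ∈ compSet G S H := by
  obtain ⟨hu', rfl⟩ := hu
  refine ⟨hv, ConnectedComponent.sound ?_⟩
  exact Adj.reachable (G := G.induce S) huv.symm

lemma exists_mem_compSet (hv : v ∈ S) : ∃ H, v ∈ compSet G S H :=
  ⟨_, hv, rfl⟩

lemma compSet_nonempty (H : (G.induce S).ConnectedComponent) : ∃ v, v ∈ compSet G S H := by
  induction H using ConnectedComponent.ind with | _ v => exact ⟨v, v.2, rfl⟩

lemma reflTransGen_of_mem_compSet (hu : u ∈ compSet G S H) (hv : v ∈ compSet G S H) :
    Relation.ReflTransGen (fun x y => x ∈ S ∧ y ∈ S ∧ G.Adj x y) u v := by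
  obtain ⟨hu', rfl⟩ := hu
  obtain ⟨hv', h⟩ := hv
  have := (reachable_iff_reflTransGen _ _).mp (ConnectedComponent.exact h.symm)
  exact this.lift Subtype.val fun x y hxy => ⟨x.2, y.2, hxy⟩

end Components

open Classical in
/-- The part of a matching inside `S`. -/
noncomputable def restrictMap (S : Set W) (m : W → W) : S → S := fun v =>
  if h : m v ∈ S then ⟨m v, h⟩ else v

lemma IsMatchingMap.restrictMap (hm : IsMatchingMap G m) (S : Set W) :
    IsMatchingMap (G.induce S) (restrictMap S m) := by
  have h1 := hm.1
  refine ⟨fun v => ?_, fun v hv => ?_⟩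
  · simp only [SimpleGraph.restrictMap]
    grind
  · simp only [SimpleGraph.restrictMap] at hv ⊢
    split_ifs at hv ⊢ with h
    · exact hm.2 v fun h' => hv (Subtype.ext h')
    · exact absurd rfl hv

lemma restrictMap_eq_self_iff {S : Set W} {v : S} :
    restrictMap S m v = v ↔ m v = v ∨ m v ∉ S := by
  by_cases h : m v ∈ S
  · simp [restrictMap, h, Subtype.ext_iff]
  · simp [restrictMap, h]

lemma coe_restrictMap_of_mem {S : Set W} {v : S} (h : m v ∈ S) :
    (restrictMap S m v : W) = m v := by
  simp [restrictMap, h]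

section Exit

variable {H : DComp G} {u v : W}

lemma IsMatchingMap.apply_mem_compSet_or (hm : IsMatchingMap G m)
    (hu : u ∈ compSet G (Dset G) H) :
    m u = u ∨ m u ∈ Aset G ∨ m u ∈ compSet G (Dset G) H := by
  by_cases h1 : m u = u
  · exact Or.inl h1
  by_cases h2 : m u ∈ Dset G
  · exact Or.inr (Or.inr (mem_compSet_of_adj hu h2 (hm.2 u h1)))
  · exact Or.inr (Or.inl (hm.apply_mem_Aset hu.1 h1 h2))

lemma IsMaximumMap.exit_unique [Finite W] (hm : IsMaximumMap G m)
    (hu : u ∈ compSet G (Dset G) H) (hv : v ∈ compSet G (Dset G) H)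
    (hmu : m u = u ∨ m u ∈ Aset G) (hmv : m v = v ∨ m v ∈ Aset G) : u = v := by
  by_contra huv
  exact hm.false_of_reflTransGen (reflTransGen_of_mem_compSet hu hv) hu.1 hv.1 huv hmu hmv

lemma IsMatchingMap.restrictMap_fixed_iff (hm : IsMatchingMap G m)
    {v : compSet G (Dset G) H} :
    SimpleGraph.restrictMap _ m v = v ↔ m v = v ∨ m v ∈ Aset G := by
  rw [restrictMap_eq_self_iff]
  have h := hm.apply_mem_compSet_or v.2
  have h2 : m v ∈ Aset G → m v ∉ compSet G (Dset G) H := fun h h' => h.1 h'.1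
  tauto

lemma IsMaximumMap.exists_exit [Finite W] (hm : IsMaximumMap G m) (H : DComp G) :
    ∃ u ∈ compSet G (Dset G) H, m u = u ∨ m u ∈ Aset G := by
  by_contra! hno
  obtain ⟨d, hd⟩ := compSet_nonempty H
  obtain ⟨n, hn, hnd⟩ := mem_Dset_iff.mp hd.1
  have h1 := (hm.1.restrictMap (compSet G (Dset G) H)).two_mul_ncard_add
  have h2 := (hn.1.restrictMap (compSet G (Dset G) H)).two_mul_ncard_add
  have h3 : fixedPoints (SimpleGraph.restrictMap (compSet G (Dset G) H) m) = ∅ := by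
    ext v
    simp only [mem_fixedPoints_iff, hm.1.restrictMap_fixed_iff, Set.mem_empty_iff_false, iff_false]
    have := hno v v.2
    tauto
  have h4 : fixedPoints (SimpleGraph.restrictMap (compSet G (Dset G) H) n) = {⟨d, hd⟩} := by
    ext v
    simp only [mem_fixedPoints_iff, hn.1.restrictMap_fixed_iff, Set.mem_singleton_iff]
    constructor
    · intro hv
      exact Subtype.ext (hn.exit_unique v.2 hd hv (Or.inl hnd))
    · rintro rfl
      exact Or.inl hnd
  rw [h3, Set.ncard_empty] at h1
  rw [h4, Set.ncard_singleton] at h2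
  lia

end Exit
/-! ### Projecting to and lifting from `G_B` -/

section Bipartite

variable {p q : Aset G ⊕ DComp G → Aset G ⊕ DComp G}

lemma GB_adj_inl_inr {a : Aset G} {H : DComp G} :
    (GB G).Adj (Sum.inl a) (Sum.inr H) ↔ ∃ d ∈ compSet G (Dset G) H, G.Adj a d := by
  rw [GB, fromRel_adj]
  constructor
  · rintro ⟨-, ⟨a', H', h1, h2, h⟩ | ⟨a', H', h1, h2, h⟩⟩
    · cases h1
      cases h2
      exact h
    · cases h1
  · intro h
    exact ⟨Sum.inl_ne_inr, Or.inl ⟨a, H, rfl, rfl, h⟩⟩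

lemma not_GB_adj_inl_inl {a b : Aset G} : ¬ (GB G).Adj (Sum.inl a) (Sum.inl b) := by
  rw [GB, fromRel_adj]
  rintro ⟨-, ⟨_, _, _, h, _⟩ | ⟨_, _, _, h, _⟩⟩ <;> cases h

lemma not_GB_adj_inr_inr {H H' : DComp G} : ¬ (GB G).Adj (Sum.inr H) (Sum.inr H') := by
  rw [GB, fromRel_adj]
  rintro ⟨-, ⟨_, _, h, _⟩ | ⟨_, _, h, _⟩⟩ <;> cases h

lemma IsMatchingMap.exists_eq_inr (hp : IsMatchingMap (GB G) p) {a : Aset G}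
    (ha : p (Sum.inl a) ≠ Sum.inl a) : ∃ H, p (Sum.inl a) = Sum.inr H := by
  have h := hp.2 _ ha
  rcases hq : p (Sum.inl a) with b | H
  · rw [hq] at h
    exact absurd h not_GB_adj_inl_inl
  · exact ⟨H, rfl⟩

lemma IsMatchingMap.eq_inr_or (hp : IsMatchingMap (GB G) p) (H : DComp G) :
    p (Sum.inr H) = Sum.inr H ∨ ∃ a, p (Sum.inr H) = Sum.inl a ∧ p (Sum.inl a) = Sum.inr H := by
  by_cases hH : p (Sum.inr H) = Sum.inr H
  · exact Or.inl hH
  have h := hp.2 _ hH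
  rcases hq : p (Sum.inr H) with b | H'
  · exact Or.inr ⟨b, rfl, hq ▸ hp.1 _⟩
  · rw [hq] at h
    exact absurd h not_GB_adj_inr_inr

lemma IsMatchingMap.ncard_fixedPoints_GB [Finite W] (hp : IsMatchingMap (GB G) p) :
    (fixedPoints p).ncard + 2 * {a | p (Sum.inl a) ≠ Sum.inl a}.ncard =
      Nat.card (Aset G ⊕ DComp G) := by
  have hinv : Function.Involutive p := hp.1
  have hc : (fixedPoints p)ᶜ = Sum.inl '' {a | p (Sum.inl a) ≠ Sum.inl a} ∪
      p '' (Sum.inl '' {a | p (Sum.inl a) ≠ Sum.inl a}) := by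
    ext x
    simp only [Set.mem_compl_iff, mem_fixedPoints_iff, Set.mem_union, Set.mem_image,
      Set.mem_ofPred_eq, exists_exists_and_eq_and]
    constructor
    · intro hx
      rcases x with a | H
      · exact Or.inl ⟨a, hx, rfl⟩
      · obtain ⟨a, -, ha⟩ := (hp.eq_inr_or H).resolve_left hx
        exact Or.inr ⟨a, by simp [ha], ha⟩
    · rintro (⟨a, ha, rfl⟩ | ⟨a, ha, rfl⟩)
      · exact ha
      · rw [hp.1]
        exact ha.symm
  rw [← Set.ncard_add_ncard_compl (fixedPoints p), hc, Set.ncard_union_eq,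
    Set.ncard_image_of_injective _ hinv.injective,
    Set.ncard_image_of_injective _ Sum.inl_injective, two_mul]
  rw [Set.disjoint_left]
  rintro _ ⟨a, -, rfl⟩ ⟨_, ⟨b, hb, rfl⟩, h⟩
  obtain ⟨H, hH⟩ := hp.exists_eq_inr hb
  rw [hH] at h
  cases h

lemma IsMaximumMap.exists_projection [Finite W] (hm : IsMaximumMap G m) :
    ∃ p, IsMatchingMap (GB G) p ∧
      (∀ a H, p (Sum.inl a) = Sum.inr H ↔ m a ∈ compSet G (Dset G) H) ∧
      (∀ a, p (Sum.inl a) ≠ Sum.inl a) ∧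
      (∀ H, p (Sum.inr H) = Sum.inr H ↔ ∃ u ∈ compSet G (Dset G) H, m u = u) ∧
      (fixedPoints m).ncard = (fixedPoints p).ncard := by
  classical
  choose e he hexit using hm.exists_exit
  have hcomp : ∀ a : Aset G, ∃ H, m a ∈ compSet G (Dset G) H := fun a =>
    exists_mem_compSet (hm.apply_mem_Dset a.2)
  choose c hc using hcomp
  have hinv := hm.1.1
  have hec : ∀ a, e (c a) = m a := fun a =>
    hm.exit_unique (he _) (hc a) (hexit _) (Or.inr (by rw [hinv]; exact a.2))
  have hfix : ∀ H, m (e H) ∉ Aset G ↔ ∃ u ∈ compSet G (Dset G) H, m u = u := by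
    intro H
    constructor
    · intro h
      exact ⟨e H, he H, (hexit H).resolve_right h⟩
    · rintro ⟨u, hu, hmu⟩ h
      have := hm.exit_unique hu (he H) (Or.inl hmu) (hexit H)
      rw [← this, hmu] at h
      exact h.1 hu.1
  let p : Aset G ⊕ DComp G → Aset G ⊕ DComp G := Sum.elim (fun a => Sum.inr (c a))
    (fun H => if h : m (e H) ∈ Aset G then Sum.inl ⟨_, h⟩ else Sum.inr H)
  have hpl : ∀ a, p (Sum.inl a) = Sum.inr (c a) := fun a => rfl
  have hpr : ∀ H (h : m (e H) ∈ Aset G), p (Sum.inr H) = Sum.inl ⟨_, h⟩ := fun H h => by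
    simp [p, h]
  have hpr' : ∀ H, m (e H) ∉ Aset G → p (Sum.inr H) = Sum.inr H := fun H h => by
    simp [p, h]
  have hcH : ∀ H (h : m (e H) ∈ Aset G), c ⟨_, h⟩ = H := fun H h => by
    refine eq_of_mem_compSet (hc _) ?_
    simpa [hinv] using he H
  have hpfix : ∀ H, p (Sum.inr H) = Sum.inr H ↔ m (e H) ∉ Aset G := by
    intro H
    refine ⟨fun h h' => ?_, hpr' H⟩
    rw [hpr H h'] at h
    cases h
  refine ⟨p, ⟨?_, ?_⟩, ?_, ?_, fun H => (hpfix H).trans (hfix H), ?_⟩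
  · rintro (a | H)
    · have h : m (e (c a)) ∈ Aset G := by rw [hec, hinv]; exact a.2
      rw [hpl, hpr _ h]
      congr 1
      apply Subtype.ext
      simp [hec, hinv]
    · by_cases h : m (e H) ∈ Aset G
      · rw [hpr H h, hpl, hcH]
      · rw [hpr' H h, hpr' H h]
  · have hadj : ∀ a, (GB G).Adj (Sum.inl a) (Sum.inr (c a)) := fun a =>
      GB_adj_inl_inr.mpr ⟨m a, hc a, hm.1.2 a (hm.ne_of_notMem_Dset a.2.1)⟩
    rintro (a | H) hne
    · exact hadj a
    · have h : m (e H) ∈ Aset G := by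
        by_contra h
        exact hne (hpr' H h)
      have := hadj ⟨_, h⟩
      rw [hcH] at this
      rw [hpr H h]
      exact this.symm
  · intro a H
    rw [hpl, Sum.inr.injEq]
    exact ⟨fun h => h ▸ hc a, fun h => eq_of_mem_compSet (hc a) h⟩
  · intro a h
    rw [hpl] at h
    cases h
  · have h1 : fixedPoints m = e '' {H | m (e H) ∉ Aset G} := by
      ext v
      simp only [mem_fixedPoints_iff, Set.mem_image, Set.mem_ofPred_eq]
      constructor
      · intro hv
        obtain ⟨H, hH⟩ := exists_mem_compSet (mem_Dset_iff.mpr ⟨m, hm, hv⟩)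
        exact ⟨H, (hfix H).mpr ⟨v, hH, hv⟩,
          hm.exit_unique (he H) hH (hexit H) (Or.inl hv)⟩
      · rintro ⟨H, hH, rfl⟩
        exact (hexit H).resolve_right hH
    have h2 : fixedPoints p = Sum.inr '' {H | m (e H) ∉ Aset G} := by
      ext x
      simp only [mem_fixedPoints_iff, Set.mem_image, Set.mem_ofPred_eq]
      rcases x with a | H
      · simp [hpl]
      · simp [hpfix]
    have he_inj : Function.Injective e := fun H H' h =>
      eq_of_mem_compSet (he H) (h ▸ he H')
    rw [h1, h2, Set.ncard_image_of_injective _ he_inj,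
      Set.ncard_image_of_injective _ Sum.inr_injective]

lemma IsMatchingMap.isMaximumMap_GB_iff [Finite W] (hp : IsMatchingMap (GB G) p) :
    IsMaximumMap (GB G) p ↔ ∀ a, p (Sum.inl a) ≠ Sum.inl a := by
  have hpc := hp.ncard_fixedPoints_GB
  constructor
  · intro hmax a ha
    obtain ⟨m, hm⟩ := exists_isMaximumMap G
    obtain ⟨q, hq, -, hqc, -⟩ := hm.exists_projection
    have h1 := hmax.2 q hq
    have h2 := hq.ncard_fixedPoints_GB
    have h3 : {a | p (Sum.inl a) ≠ Sum.inl a}.ncard < {a | q (Sum.inl a) ≠ Sum.inl a}.ncard := by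
      refine Set.ncard_lt_ncard (Set.ssubset_iff_of_subset ?_ |>.mpr ⟨a, hqc a, ?_⟩)
      · exact fun b _ => hqc b
      · exact fun h => h ha
    lia
  · intro h
    refine ⟨hp, fun q hq => ?_⟩
    have h1 := hq.ncard_fixedPoints_GB
    have h2 : {a | q (Sum.inl a) ≠ Sum.inl a}.ncard ≤ {a | p (Sum.inl a) ≠ Sum.inl a}.ncard :=
      Set.ncard_le_ncard fun b _ => h b
    lia

lemma IsMaximumMap.apply_mem_Cset [Finite W] (hm : IsMaximumMap G m) {v : W}
    (hv : v ∈ Cset G) : m v ∈ Cset G := by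
  have hne := hm.ne_of_notMem_Dset hv.1
  refine ⟨fun h => hv.2 ⟨hv.1, _, h, hm.1.2 v hne⟩, fun h => hv.1 ?_⟩
  have := hm.apply_mem_Dset h
  rwa [hm.1.1] at this

lemma IsMaximumMap.apply_mem_compSet [Finite W] (hm : IsMaximumMap G m) {H : DComp G} {u v : W}
    (hu : u ∈ compSet G (Dset G) H) (hmu : m u = u) (hv : v ∈ compSet G (Dset G) H) :
    m v ∈ compSet G (Dset G) H := by
  rcases hm.1.apply_mem_compSet_or hv with h | h | h
  · rwa [h]
  · have := hm.exit_unique hu hv (Or.inl hmu) (Or.inr h)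
    rw [← this, hmu] at h
    exact absurd hu.1 h.1
  · exact h

/-- A matching of `G_B` covering `A(G)` lifts to a maximum matching of `G` in which each component
`H` of `G[D(G)]` is entered or left uncovered at the prescribed vertex `b H`. -/
lemma IsMatchingMap.exists_lift [Finite W] (hp : IsMatchingMap (GB G) p)
    (hcov : ∀ a, p (Sum.inl a) ≠ Sum.inl a) {b : DComp G → W}
    (hb : ∀ H, b H ∈ compSet G (Dset G) H)
    (hadj : ∀ a H, p (Sum.inl a) = Sum.inr H → G.Adj a (b H)) :
    ∃ m, IsMaximumMap G m ∧ (∀ a H, p (Sum.inl a) = Sum.inr H → m a = b H) ∧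
      fixedPoints m = b '' {H | p (Sum.inr H) = Sum.inr H} := by
  classical
  choose c hc using fun a => hp.exists_eq_inr (hcov a)
  choose K hK hKb using fun H => mem_Dset_iff.mp (hb H).1
  obtain ⟨m₀, hm₀⟩ := exists_isMaximumMap G
  let r : DComp G → W := fun H => Sum.elim (fun a : Aset G => (a : W)) (fun _ => b H) (p (Sum.inr H))
  let m : W → W := fun v =>
    if h : v ∈ Aset G then b (c ⟨v, h⟩)
    else if h : v ∈ Dset G then
      if v = b ((G.induce (Dset G)).connectedComponentMk ⟨v, h⟩) then
        r ((G.induce (Dset G)).connectedComponentMk ⟨v, h⟩)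
      else K ((G.induce (Dset G)).connectedComponentMk ⟨v, h⟩) v
    else m₀ v
  have hmA : ∀ a : Aset G, m a = b (c a) := fun a => by simp [m]
  have hmD : ∀ {v H}, v ∈ compSet G (Dset G) H → m v = if v = b H then r H else K H v := by
    rintro v H ⟨hv, rfl⟩
    have hvA : v ∉ Aset G := fun h => h.1 hv
    simp only [m, dif_neg hvA, dif_pos hv]
  have hmb : ∀ H, m (b H) = r H := fun H => by rw [hmD (hb H), if_pos rfl]
  have hmK : ∀ {v H}, v ∈ compSet G (Dset G) H → v ≠ b H → m v = K H v := fun hv hne => by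
    rw [hmD hv, if_neg hne]
  have hmC : ∀ {v}, v ∈ Cset G → m v = m₀ v := fun hv => by
    simp only [m, dif_neg hv.1, dif_neg hv.2]
  have hr : ∀ {H a}, p (Sum.inr H) = Sum.inl a → r H = a := fun h => by simp [r, h]
  have hr' : ∀ {H}, p (Sum.inr H) = Sum.inr H → r H = b H := fun h => by simp [r, h]
  have hKne : ∀ {v H}, v ∈ compSet G (Dset G) H → v ≠ b H → K H v ≠ v := fun hv hne h =>
    hne ((hK _).exit_unique hv (hb _) (Or.inl h) (Or.inl (hKb _)))
  have hcases : ∀ v : W, (∃ a : Aset G, v = (a : W)) ∨ (∃ H, v = b H) ∨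
      (∃ H, v ∈ compSet G (Dset G) H ∧ v ≠ b H) ∨ v ∈ Cset G := by
    intro v
    by_cases hA : v ∈ Aset G
    · exact Or.inl ⟨⟨v, hA⟩, rfl⟩
    by_cases hD : v ∈ Dset G
    · obtain ⟨H, hH⟩ := exists_mem_compSet hD
      by_cases hbH : v = b H
      · exact Or.inr (Or.inl ⟨H, hbH⟩)
      · exact Or.inr (Or.inr (Or.inl ⟨H, hH, hbH⟩))
    · exact Or.inr (Or.inr (Or.inr ⟨hD, hA⟩))
  have hmm : IsMatchingMap G m := by
    refine ⟨fun v => ?_, fun v hv => ?_⟩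
    · rcases hcases v with ⟨a, rfl⟩ | ⟨H, rfl⟩ | ⟨H, hH, hne⟩ | hC
      · rw [hmA, hmb, hr]
        rw [← hc, hp.1]
      · rw [hmb]
        rcases hp.eq_inr_or H with h | ⟨a, h, h'⟩
        · rw [hr' h, hmb, hr' h]
        · rw [hr h, hmA]
          rw [hc, Sum.inr.injEq] at h'
          rw [h']
      · have hne' : K H v ≠ b H := fun h => hne (by rw [← (hK H).1.1 v, h, hKb])
        rw [hmK hH hne, hmK ((hK H).apply_mem_compSet (hb H) (hKb H) hH) hne', (hK H).1.1]
      · rw [hmC hC, hmC (hm₀.apply_mem_Cset hC), hm₀.1.1]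
    · rcases hcases v with ⟨a, rfl⟩ | ⟨H, rfl⟩ | ⟨H, hH, hne⟩ | hC
      · rw [hmA]
        exact hadj a _ (hc a)
      · rw [hmb] at hv ⊢
        rcases hp.eq_inr_or H with h | ⟨a, h, h'⟩
        · exact absurd (hr' h) hv
        · rw [hr h]
          exact (hadj a H h').symm
      · rw [hmK hH hne]
        exact (hK H).1.2 v (hKne hH hne)
      · rw [hmC hC]
        exact hm₀.1.2 v (hm₀.ne_of_notMem_Dset hC.1)
  have hfix : fixedPoints m = b '' {H | p (Sum.inr H) = Sum.inr H} := by
    ext v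
    simp only [mem_fixedPoints_iff, Set.mem_image, Set.mem_ofPred_eq]
    constructor
    · intro hv
      rcases hcases v with ⟨a, rfl⟩ | ⟨H, rfl⟩ | ⟨H, hH, hne⟩ | hC
      · rw [hmA] at hv
        exact absurd (hb (c a)).1 (hv ▸ a.2.1)
      · refine ⟨H, (hp.eq_inr_or H).resolve_right ?_, rfl⟩
        rintro ⟨a, h, -⟩
        rw [hmb, hr h] at hv
        exact a.2.1 (hv ▸ (hb H).1)
      · rw [hmK hH hne] at hv
        exact absurd hv (hKne hH hne)
      · rw [hmC hC] at hv
        exact absurd hv (hm₀.ne_of_notMem_Dset hC.1)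
    · rintro ⟨H, hH, rfl⟩
      rw [hmb, hr' hH]
  refine ⟨m, hm₀.of_ncard_le hmm ?_, fun a H h => ?_, hfix⟩
  · obtain ⟨q, hq, -, hqc, -, hcard⟩ := hm₀.exists_projection
    have hb_inj : Function.Injective b := fun H H' h => eq_of_mem_compSet (hb H) (h ▸ hb H')
    rw [hcard, ← (hp.isMaximumMap_GB_iff.mpr hcov).ncard_eq (hq.isMaximumMap_GB_iff.mpr hqc),
      hfix, Set.ncard_image_of_injective _ hb_inj,
      ← Set.ncard_image_of_injective _ (Sum.inr_injective (α := Aset G))]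
    refine Set.ncard_le_ncard ?_
    rintro _ ⟨H, hH, rfl⟩
    exact hH
  · rw [hc, Sum.inr.injEq] at h
    rw [hmA, h]

end Bipartite
/-! ### Gluing matchings -/

open Classical in
/-- Replace `m` by `n` inside `S`. -/
noncomputable def glueMap {S : Set W} (n : S → S) (m : W → W) : W → W := fun v =>
  if h : v ∈ S then n ⟨v, h⟩ else m v

lemma glueMap_coe {S : Set W} (n : S → S) (m : W → W) (v : S) : glueMap n m v = n v := by
  simp [glueMap]

lemma glueMap_of_notMem {S : Set W} (n : S → S) (m : W → W) {v : W} (hv : v ∉ S) :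
    glueMap n m v = m v := by
  simp [glueMap, hv]

lemma IsMatchingMap.glueMap {S : Set W} {n : S → S} (hm : IsMatchingMap G m)
    (hn : IsMatchingMap (G.induce S) n) (hS : ∀ v ∈ S, m v ∈ S) :
    IsMatchingMap G (glueMap n m) := by
  refine ⟨fun v => ?_, fun v hv => ?_⟩
  · by_cases h : v ∈ S
    · lift v to S using h
      rw [glueMap_coe, glueMap_coe, hn.1]
    · rw [glueMap_of_notMem n m h, glueMap_of_notMem, hm.1]
      exact fun h' => h (hm.1 v ▸ hS _ h')
  · by_cases h : v ∈ S
    · lift v to S using h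
      rw [glueMap_coe] at hv ⊢
      exact hn.2 v fun h' => hv (congrArg _ h')
    · rw [glueMap_of_notMem n m h] at hv ⊢
      exact hm.2 v hv

lemma UniqueMap.eq_restrictMap {S : Set W} {n : S → S} (hu : UniqueMap G m)
    (hm : IsMatchingMap G m) (hn : IsMatchingMap (G.induce S) n) (hS : ∀ v ∈ S, m v ∈ S)
    (hfix : ∀ v, n v = v ↔ m v = v) : n = restrictMap S m := by
  have h : SimpleGraph.glueMap n m = m := by
    refine hu _ (hm.glueMap hn hS) ?_
    ext v
    simp only [mem_fixedPoints_iff]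
    by_cases h : v ∈ S
    · lift v to S using h
      rw [glueMap_coe, ← hfix, Subtype.ext_iff]
    · rw [glueMap_of_notMem n m h]
  funext v
  apply Subtype.ext
  rw [coe_restrictMap_of_mem (hS v v.2), ← glueMap_coe n m v, h]

lemma IsMaximumMap.apply_mem_compSet_Cset [Finite W] (hm : IsMaximumMap G m)
    {H : (G.induce (Cset G)).ConnectedComponent} {v : W} (hv : v ∈ compSet G (Cset G) H) :
    m v ∈ compSet G (Cset G) H :=
  mem_compSet_of_adj hv (hm.apply_mem_Cset hv.1)
    (hm.1.2 v (hm.ne_of_notMem_Dset (mem_of_mem_compSet hv).1))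

lemma IsMaximumMap.restrictMap_Cset_ne [Finite W] (hm : IsMaximumMap G m)
    {H : (G.induce (Cset G)).ConnectedComponent} (v : compSet G (Cset G) H) :
    restrictMap _ m v ≠ v := by
  rw [Ne, restrictMap_eq_self_iff, not_or, not_not]
  exact ⟨hm.ne_of_notMem_Dset (mem_of_mem_compSet v.2).1, hm.apply_mem_compSet_Cset v.2⟩

/-! ### The characterisation for matching maps -/

lemma existsUnique_perfect_of_forall_uniqueMap [Finite W]
    (h : ∀ m, IsMaximumMap G m → UniqueMap G m)
    (H : (G.induce (Cset G)).ConnectedComponent) :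
    ∃! n : compSet G (Cset G) H → compSet G (Cset G) H,
      IsMatchingMap (G.induce (compSet G (Cset G) H)) n ∧ ∀ v, n v ≠ v := by
  obtain ⟨m, hm⟩ := exists_isMaximumMap G
  refine ⟨restrictMap _ m, ⟨hm.1.restrictMap _, hm.restrictMap_Cset_ne⟩, ?_⟩
  rintro n ⟨hn, hne⟩
  refine (h m hm).eq_restrictMap hm.1 hn (fun v hv => hm.apply_mem_compSet_Cset hv) fun v => ?_
  exact iff_of_false (hne v) (hm.ne_of_notMem_Dset (mem_of_mem_compSet v.2).1)

lemma uniqueMap_nearPerfect_of_forall_uniqueMap [Finite W]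
    (h : ∀ m, IsMaximumMap G m → UniqueMap G m) {H : DComp G}
    {n : compSet G (Dset G) H → compSet G (Dset G) H}
    (hn : IsMatchingMap (G.induce (compSet G (Dset G) H)) n) (hu : ∃ u, fixedPoints n = {u}) :
    UniqueMap (G.induce (compSet G (Dset G) H)) n := by
  obtain ⟨u, hu⟩ := hu
  obtain ⟨m, hm, hmu⟩ := mem_Dset_iff.mp (mem_of_mem_compSet u.2)
  have key : ∀ k, IsMatchingMap (G.induce (compSet G (Dset G) H)) k → fixedPoints k = {u} →
      k = restrictMap _ m := by
    intro k hk hku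
    refine (h m hm).eq_restrictMap hm.1 hk (fun v hv => hm.apply_mem_compSet u.2 hmu hv) ?_
    intro v
    rw [← mem_fixedPoints_iff, hku, Set.mem_singleton_iff]
    constructor
    · rintro rfl
      exact hmu
    · intro hv
      exact Subtype.ext (hm.exit_unique v.2 u.2 (Or.inl hv) (Or.inl hmu))
  intro k hk hkn
  rw [key n hn hu, key k hk (hkn.trans hu)]

section Bipartite

variable {p q : Aset G ⊕ DComp G → Aset G ⊕ DComp G}

lemma IsMatchingMap.exists_entry (hp : IsMatchingMap (GB G) p) {b₀ : DComp G → W}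
    (hb₀ : ∀ H, b₀ H ∈ compSet G (Dset G) H) :
    ∃ b : DComp G → W, (∀ H, b H ∈ compSet G (Dset G) H) ∧
      (∀ a H, p (Sum.inl a) = Sum.inr H → G.Adj a (b H)) ∧
      ∀ H, p (Sum.inr H) = Sum.inr H → b H = b₀ H := by
  have : ∀ H, ∃ d ∈ compSet G (Dset G) H, (∀ a, p (Sum.inl a) = Sum.inr H → G.Adj a d) ∧
      (p (Sum.inr H) = Sum.inr H → d = b₀ H) := by
    intro H
    rcases hp.eq_inr_or H with h | ⟨a, h, h'⟩
    · refine ⟨b₀ H, hb₀ H, fun a ha => ?_, fun _ => rfl⟩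
      have h' := hp.1 (Sum.inl a)
      rw [ha, h] at h'
      cases h'
    · have hadj := hp.2 (Sum.inl a) (by simp [h'])
      rw [h', GB_adj_inl_inr] at hadj
      obtain ⟨d, hd, hadj⟩ := hadj
      refine ⟨d, hd, fun a' ha' => ?_, fun hH => ?_⟩
      · rw [← ha', hp.1, Sum.inl.injEq] at h
        rwa [h]
      · rw [h] at hH
        cases hH
  choose b hb h1 h2 using this
  exact ⟨b, hb, fun a H => h1 H a, h2⟩

lemma uniqueMap_GB_of_forall_uniqueMap [Finite W]
    (h : ∀ m, IsMaximumMap G m → UniqueMap G m) (hp : IsMaximumMap (GB G) p) :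
    UniqueMap (GB G) p := by
  intro q hq hqp
  have hqmax : IsMaximumMap (GB G) q := hp.of_ncard_le hq (by rw [hqp])
  have hpc := hp.1.isMaximumMap_GB_iff.mp hp
  have hqc := hq.isMaximumMap_GB_iff.mp hqmax
  have hqp' : ∀ x, q x = x ↔ p x = x := fun x => by
    rw [← mem_fixedPoints_iff, hqp, mem_fixedPoints_iff]
  choose b₀ hb₀ using compSet_nonempty (G := G) (S := Dset G)
  obtain ⟨b, hb, hbadj, hbb₀⟩ := hp.1.exists_entry hb₀
  obtain ⟨c, hc, hcadj, hcb₀⟩ := hq.exists_entry hb₀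
  obtain ⟨m, hm, hmb, hmfix⟩ := hp.1.exists_lift hpc hb hbadj
  obtain ⟨n, hn, hnc, hnfix⟩ := hq.exists_lift hqc hc hcadj
  have hnm : n = m := by
    refine h m hm n hn.1 ?_
    rw [hmfix, hnfix]
    simp only [hqp']
    refine Set.image_congr fun H hH => ?_
    rw [hbb₀ H hH, hcb₀ H ((hqp' _).mpr hH)]
  have hinl : ∀ a, q (Sum.inl a) = p (Sum.inl a) := by
    intro a
    obtain ⟨H, hH⟩ := hp.1.exists_eq_inr (hpc a)
    obtain ⟨H', hH'⟩ := hq.exists_eq_inr (hqc a)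
    have h1 := hb H
    rw [← hmb a H hH, ← hnm, hnc a H' hH'] at h1
    rw [hH, hH', eq_of_mem_compSet (hc H') h1]
  funext x
  rcases x with a | H
  · exact hinl a
  · rcases hp.1.eq_inr_or H with hH | ⟨a, hH, hH'⟩
    · rw [hH, (hqp' _).mpr hH]
    · rw [hH, ← hH', ← hinl, hq.1]

lemma existsUnique_adj_of_forall_uniqueMap [Finite W]
    (h : ∀ m, IsMaximumMap G m → UniqueMap G m) (hp : IsMaximumMap (GB G) p) {a : Aset G}
    {H : DComp G} (haH : p (Sum.inl a) = Sum.inr H) :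
    ∃! d, d ∈ compSet G (Dset G) H ∧ G.Adj a d := by
  classical
  have hpc := hp.1.isMaximumMap_GB_iff.mp hp
  have hadj := hp.1.2 _ (hpc a)
  rw [haH, GB_adj_inl_inr] at hadj
  obtain ⟨d, hd, had⟩ := hadj
  refine ⟨d, ⟨hd, had⟩, ?_⟩
  rintro d' ⟨hd', had'⟩
  choose b₀ hb₀ using compSet_nonempty (G := G) (S := Dset G)
  obtain ⟨b, hb, hbadj, -⟩ := hp.1.exists_entry hb₀
  have hlift : ∀ x ∈ compSet G (Dset G) H, G.Adj a x → ∃ m, IsMaximumMap G m ∧ m a = x ∧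
      fixedPoints m = b '' {H | p (Sum.inr H) = Sum.inr H} := by
    intro x hx hax
    obtain ⟨m, hm, hmb, hmfix⟩ := hp.1.exists_lift hpc (b := update b H x) (fun H' => by
      rcases eq_or_ne H' H with rfl | hne
      · simpa using hx
      · simpa [hne] using hb H') (fun a' H' h' => by
      rcases eq_or_ne H' H with rfl | hne
      · have : a' = a := by
          rw [← Sum.inl.injEq (β := DComp G), ← hp.1.1 (Sum.inl a'), h', ← haH, hp.1.1]
        simpa [this] using hax
      · simpa [hne] using hbadj a' H' h')
    refine ⟨m, hm, by simpa using hmb a H haH, hmfix.trans (Set.image_congr fun H' hH' => ?_)⟩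
    refine update_of_ne ?_ _ _
    rintro rfl
    rw [Set.mem_ofPred_eq, ← haH, hp.1.1, haH] at hH'
    cases hH'
  obtain ⟨m, hm, hma, hmfix⟩ := hlift d hd had
  obtain ⟨n, hn, hna, hnfix⟩ := hlift d' hd' had'
  rw [← hma, ← hna, h m hm n hn.1 (hnfix.trans hmfix.symm)]

lemma uniqueMap_of_components [Finite W]
    (hC : ∀ H : (G.induce (Cset G)).ConnectedComponent,
      ∃! n : compSet G (Cset G) H → compSet G (Cset G) H,
        IsMatchingMap (G.induce (compSet G (Cset G) H)) n ∧ ∀ v, n v ≠ v)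
    (hD : ∀ (H : DComp G) (n : compSet G (Dset G) H → compSet G (Dset G) H),
      IsMatchingMap (G.induce (compSet G (Dset G) H)) n → (∃ u, fixedPoints n = {u}) →
        UniqueMap (G.induce (compSet G (Dset G) H)) n)
    (hB : ∀ p, IsMaximumMap (GB G) p → UniqueMap (GB G) p)
    (hadj : ∀ (a : Aset G) (H : DComp G),
      (∃ p, IsMaximumMap (GB G) p ∧ p (Sum.inl a) = Sum.inr H) →
        ∃! d, d ∈ compSet G (Dset G) H ∧ G.Adj a d)
    (hm : IsMaximumMap G m) : UniqueMap G m := by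
  intro n hn hnm
  have hnmax : IsMaximumMap G n := hm.of_ncard_le hn (by rw [hnm])
  have hfix : ∀ v, n v = v ↔ m v = v := fun v => by
    rw [← mem_fixedPoints_iff, hnm, mem_fixedPoints_iff]
  obtain ⟨p, hp, hpm, hpc, hpfix, -⟩ := hm.exists_projection
  obtain ⟨q, hq, hqn, hqc, hqfix, -⟩ := hnmax.exists_projection
  have hpmax := hp.isMaximumMap_GB_iff.mpr hpc
  have hqp : q = p := by
    refine hB p hpmax q hq ?_
    ext x
    rw [mem_fixedPoints_iff, mem_fixedPoints_iff]
    rcases x with a | H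
    · exact iff_of_false (hqc a) (hpc a)
    · simp only [hpfix, hqfix, hfix]
  have hA : ∀ a ∈ Aset G, n a = m a := by
    intro a ha
    obtain ⟨H, hH⟩ := exists_mem_compSet (hm.apply_mem_Dset ha)
    have hpH := (hpm ⟨a, ha⟩ H).mpr hH
    have hH' := (hqn ⟨a, ha⟩ H).mp (hqp ▸ hpH)
    exact (hadj ⟨a, ha⟩ H ⟨p, hpmax, hpH⟩).unique
      ⟨hH', hn.2 a (hnmax.ne_of_notMem_Dset ha.1)⟩ ⟨hH, hm.1.2 a (hm.ne_of_notMem_Dset ha.1)⟩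
  have hexit : ∀ v, m v = v ∨ m v ∈ Aset G → n v = m v := by
    rintro v (hv | hv)
    · rw [hv, (hfix v).mpr hv]
    · have := hA _ hv
      rw [hm.1.1] at this
      rw [← this, hn.1, this]
  have hexit' : ∀ v, n v ∈ Aset G → n v = m v := by
    intro v hv
    have := hA _ hv
    rw [hn.1] at this
    conv_rhs => rw [this, hm.1.1]
  funext v
  by_cases hvA : v ∈ Aset G
  · exact hA v hvA
  by_cases hvD : v ∈ Dset G
  · obtain ⟨H, hH⟩ := exists_mem_compSet hvD
    obtain ⟨u, hu, hmu⟩ := hm.exists_exit H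
    have hnu : n u = u ∨ n u ∈ Aset G := by rwa [hexit u hmu]
    have hres : ∀ k, IsMaximumMap G k → (k u = u ∨ k u ∈ Aset G) →
        fixedPoints (restrictMap (compSet G (Dset G) H) k) = {⟨u, hu⟩} := by
      intro k hk hku
      ext w
      rw [mem_fixedPoints_iff, hk.1.restrictMap_fixed_iff, Set.mem_singleton_iff]
      refine ⟨fun hw => Subtype.ext (hk.exit_unique w.2 hu hw hku), ?_⟩
      rintro rfl
      exact hku
    have heq := hD H _ (hm.1.restrictMap _) ⟨_, hres m hm hmu⟩ _ (hn.restrictMap _)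
      ((hres n hnmax hnu).trans (hres m hm hmu).symm)
    rcases hm.1.apply_mem_compSet_or hH with h | h | h
    · exact hexit v (Or.inl h)
    · exact hexit v (Or.inr h)
    rcases hn.apply_mem_compSet_or hH with h' | h' | h'
    · rw [h', (hfix v).mp h']
    · exact hexit' v h'
    · rw [← coe_restrictMap_of_mem (v := ⟨v, hH⟩) h, ← coe_restrictMap_of_mem (v := ⟨v, hH⟩) h',
        heq]
  · obtain ⟨H, hH⟩ := exists_mem_compSet (G := G) (S := Cset G) ⟨hvD, hvA⟩
    have heq := (hC H).unique ⟨hn.restrictMap _, hnmax.restrictMap_Cset_ne⟩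
      ⟨hm.1.restrictMap _, hm.restrictMap_Cset_ne⟩
    rw [← coe_restrictMap_of_mem (v := ⟨v, hH⟩) (hm.apply_mem_compSet_Cset hH),
      ← coe_restrictMap_of_mem (v := ⟨v, hH⟩) (hnmax.apply_mem_compSet_Cset hH), heq]

end Bipartite

/-! ### Translation to sets of edges -/

lemma existsUnique_isPerfectMatchingSet_iff :
    (∃! N, IsPerfectMatchingSet G N) ↔ ∃! n, IsMatchingMap G n ∧ ∀ v, n v ≠ v := by
  have hperf : ∀ n, IsMatchingMap G n →
      (IsPerfectMatchingSet G (mapEdges n) ↔ ∀ v, n v ≠ v) := by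
    intro n hn
    rw [IsPerfectMatchingSet, hn.matVerts_mapEdges, Set.compl_univ_iff,
      Set.eq_empty_iff_forall_notMem]
    exact and_iff_right hn.isMatchingSet
  constructor
  · rintro ⟨N, hN, huniq⟩
    obtain ⟨n, hn, rfl⟩ := exists_isMatchingMap hN.1
    refine ⟨n, ⟨hn, (hperf n hn).mp hN⟩, ?_⟩
    rintro k ⟨hk, hkv⟩
    exact hk.mapEdges_inj hn (huniq _ ((hperf k hk).mpr hkv))
  · rintro ⟨n, ⟨hn, hnv⟩, huniq⟩
    refine ⟨mapEdges n, (hperf n hn).mpr hnv, fun K hK => ?_⟩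
    obtain ⟨k, hk, rfl⟩ := exists_isMatchingMap hK.1
    rw [huniq k ⟨hk, (hperf k hk).mp hK⟩]

lemma forall_nearPerfect_uniquelyRestricted_iff :
    (∀ N, IsMatchingSet G N → (∃ u, matVerts N = {u}ᶜ) → UniquelyRestricted G N) ↔
      ∀ n, IsMatchingMap G n → (∃ u, fixedPoints n = {u}) → UniqueMap G n := by
  constructor
  · rintro h n hn ⟨u, hu⟩
    refine hn.uniquelyRestricted_iff.mp (h _ hn.isMatchingSet ⟨u, ?_⟩)
    rw [hn.matVerts_mapEdges, hu]
  · rintro h N hN ⟨u, hu⟩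
    obtain ⟨n, hn, rfl⟩ := exists_isMatchingMap hN
    rw [hn.matVerts_mapEdges, compl_inj_iff] at hu
    exact hn.uniquelyRestricted_iff.mpr (h n hn ⟨u, hu⟩)

lemma exists_isMaximumMatching_mem_iff [Finite W] {x y : W} (hxy : x ≠ y) :
    (∃ M, IsMaximumMatching G M ∧ s(x, y) ∈ M) ↔ ∃ m, IsMaximumMap G m ∧ m x = y := by
  constructor
  · rintro ⟨M, hM, hmem⟩
    obtain ⟨m, hm, rfl⟩ := exists_isMatchingMap hM.1
    exact ⟨m, hm.isMaximumMatching_iff.mp hM, (hm.mk_mem_mapEdges.mp hmem).2⟩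
  · rintro ⟨m, hm, hmem⟩
    exact ⟨_, hm.1.isMaximumMatching_iff.mpr hm, hm.1.mk_mem_mapEdges.mpr ⟨hxy, hmem⟩⟩

end SimpleGraph

/-- Every maximum matching of `G` is uniquely restricted iff (i) every component of
`G[C(G)]` has a unique perfect matching, (ii) every near-perfect matching of every
component of `G[D(G)]` is uniquely restricted, (iii) every maximum matching of `G_B`
is uniquely restricted, and (iv) every edge `aH` of `G_B` in some maximum matching of
`G_B` is such that `a` has a unique neighbor in `V(H)`. -/
theorem stmt18 [Fintype V] (G : SimpleGraph V) :
    (∀ M, IsMaximumMatching G M → UniquelyRestricted G M) ↔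
      ((∀ H : (G.induce (Cset G)).ConnectedComponent,
        ∃! N : Set (Sym2 ↥(compSet G (Cset G) H)),
          IsPerfectMatchingSet (G.induce (compSet G (Cset G) H)) N) ∧
      (∀ H : DComp G, ∀ N : Set (Sym2 ↥(compSet G (Dset G) H)),
        IsMatchingSet (G.induce (compSet G (Dset G) H)) N →
        (∃ u, matVerts N = {u}ᶜ) →
        UniquelyRestricted (G.induce (compSet G (Dset G) H)) N) ∧
      (∀ MB, IsMaximumMatching (GB G) MB → UniquelyRestricted (GB G) MB) ∧
      (∀ (a : ↥(Aset G)) (H : DComp G),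
        (∃ MB, IsMaximumMatching (GB G) MB ∧ s(Sum.inl a, Sum.inr H) ∈ MB) →
        ∃! d, d ∈ compSet G (Dset G) H ∧ G.Adj a.1 d)) := by
  simp only [SimpleGraph.forall_uniquelyRestricted_iff,
    SimpleGraph.existsUnique_isPerfectMatchingSet_iff,
    SimpleGraph.forall_nearPerfect_uniquelyRestricted_iff,
    SimpleGraph.exists_isMaximumMatching_mem_iff Sum.inl_ne_inr]
  constructor
  · intro h
    refine ⟨SimpleGraph.existsUnique_perfect_of_forall_uniqueMap h,
      fun H n hn hu => SimpleGraph.uniqueMap_nearPerfect_of_forall_uniqueMap h hn hu,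
      fun p hp => SimpleGraph.uniqueMap_GB_of_forall_uniqueMap h hp, ?_⟩
    rintro a H ⟨p, hp, haH⟩
    exact SimpleGraph.existsUnique_adj_of_forall_uniqueMap h hp haH
  · rintro ⟨hC, hD, hB, hadj⟩ m hm
    exact SimpleGraph.uniqueMap_of_components hC hD hB hadj hm
end
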